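/- arXiv:1503.06290 — 2 statements merged into one kernel-verified Lean document; each statement's English description precedes it below -/
import Mathlib

section
/- Let ν, μ, z ∈ ℂ with Re ν > 0, 0 < Re μ < 2 and Re μ < Re ν + 1. Then (√2·sin(πμ)/√π) · ∫₀^∞ x^(μ−1) · e^(−z·x − x²/2) · ((1/Γ(ν)) ∫₀^∞ e^(−x²·u) · u^(ν−1) · (1+u)^(μ−ν−1) du) dx = (e^(z²/2)/(Γ(ν)·Γ(ν+1−μ))) · [ e^(iπμ/2) · (∫₀^∞ e^(−i·z·t − t²/2) t^(ν−1) dt) · (∫₀^∞ e^(i·z·s − s²/2) s^(ν−μ) ds) + e^(−iπμ/2) · (∫₀^∞ e^(i·z·t − t²/2) t^(ν−1) dt) · (∫₀^∞ e^(−i·z·s − s²/2) s^(ν−μ) ds) ]. (This is Theorem 2, eq. (19) with a = 1: (√2·sin(πμ)/√π)·∫₀^∞ x^(μ−1) e^(−zx−x²/2) Ψ(ν,μ;x²) dx = e^(iπμ/2)·D₋ν(iz)·D_(μ−ν−1)(−iz) + e^(−iπμ/2)·D₋ν(−iz)·D_(μ−ν−1)(iz), written with Ψ and each D replaced by their integral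 representations.) -/
open MeasureTheory Complex Set


lemma meas_cpow (a : ℂ) : Measurable (fun t : ℝ => (t:ℂ)^a) := by fun_prop
lemma rI {a p : ℝ} (ha : 0 < a) (hp : 0 < p) :
    IntegrableOn (fun t : ℝ => t^(a-1) * Real.exp (-(p*t))) (Ioi 0) := by
  have := integrableOn_rpow_mul_exp_neg_mul_rpow (p := 1) (s := a - 1) (b := p) (by linarith) one_pos hp
  simpa [Real.rpow_one, neg_mul] using this

lemma cI {a p : ℂ} (ha : 0 < a.re) (hp : 0 < p.re) :
    IntegrableOn (fun t : ℝ => (t:ℂ)^(a-1) * cexp (-(p*t))) (Ioi 0) := by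
  refine Integrable.mono' (rI ha hp) (by fun_prop) ?_
  filter_upwards [ae_restrict_mem measurableSet_Ioi] with t ht
  rw [norm_mul, norm_cpow_eq_rpow_re_of_pos ht, norm_exp]
  simp

lemma lap_diff {f : ℝ → ℂ} (hm : AEStronglyMeasurable f (volume.restrict (Ioi 0)))
    (hf : ∀ δ : ℝ, 0 < δ → IntegrableOn (fun s : ℝ => ‖f s‖ * Real.exp (-(δ * s))) (Ioi 0)) :
    DifferentiableOn ℂ (fun q : ℂ => ∫ s in Ioi (0:ℝ), f s * cexp (-(q * s))) {q | 0 < q.re} := by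
  intro q hq
  have hq : 0 < q.re := hq
  refine DifferentiableAt.differentiableWithinAt ?_
  set δ := q.re / 4 with hδ
  have hδ0 : 0 < δ := by positivity
  have hnb : {w : ℂ | 2 * δ < w.re} ∈ nhds q := by
    refine (isOpen_lt continuous_const Complex.continuous_re).mem_nhds ?_
    show 2 * δ < q.re; linarith
  refine ((hasDerivAt_integral_of_dominated_loc_of_deriv_le 
    (F' := fun w s => f s * (cexp (-(w * s)) * (-s)))
    (bound := fun s => (1/δ) * (‖f s‖ * Real.exp (-(δ * s)))) hnb ?_ ?_ ?_ ?_ ?_ ?_).2).differentiableAt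
  · refine Filter.Eventually.of_forall fun w => hm.mul (by fun_prop)
  · refine Integrable.mono' (hf q.re hq) (hm.mul (by fun_prop)) ?_
    refine Filter.Eventually.of_forall fun s => ?_
    rw [norm_mul, norm_exp]; simp
  · exact hm.mul (by fun_prop)
  · filter_upwards [ae_restrict_mem measurableSet_Ioi] with s hs w hw
    have hs : 0 < s := hs
    have hw : 2 * δ < w.re := hw
    rw [norm_mul, norm_mul, norm_exp, norm_neg, norm_real, Real.norm_of_nonneg hs.le]
    have h1 : (-(w * (s:ℂ))).re = -(w.re * s) := by simp
    rw [h1]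
    have h2 : δ * s ≤ Real.exp (δ * s) := by linarith [Real.add_one_le_exp (δ * s)]
    have h3 : Real.exp (-(w.re * s)) ≤ Real.exp (-(δ*s)) * Real.exp (-(δ*s)) := by
      rw [← Real.exp_add]; apply Real.exp_le_exp.2; nlinarith
    have h4 : Real.exp (-(δ*s)) * s ≤ 1/δ := by
      rw [Real.exp_neg, inv_mul_le_iff₀ (Real.exp_pos _), mul_one_div, le_div_iff₀ hδ0]; linarith
    calc ‖f s‖ * (Real.exp (-(w.re * s)) * s) 
        ≤ ‖f s‖ * (Real.exp (-(δ*s)) * Real.exp (-(δ*s)) * s) := by gcongr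
      _ = (Real.exp (-(δ*s)) * s) * (‖f s‖ * Real.exp (-(δ * s))) := by ring
      _ ≤ _ := by gcongr
  · exact (hf δ hδ0).const_mul _
  · refine Filter.Eventually.of_forall fun s w _ => ?_
    refine HasDerivAt.const_mul _ ?_
    refine HasDerivAt.cexp ?_
    have h := ((hasDerivAt_id w).mul_const (s:ℂ)).fun_neg
    rw [one_mul] at h
    exact h

noncomputable def LL (ν w : ℂ) : ℂ := ∫ t in Ioi (0:ℝ), (t:ℂ)^(ν-1) * cexp (-(w*t))
noncomputable def KK (ν β w : ℂ) : ℂ :=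
  ∫ u in Ioi (0:ℝ), ((u:ℂ)^(ν-1) * ((1:ℂ)+u)^(-β)) * cexp (-(w*u))

lemma norm_one_add_cpow {u : ℝ} (hu : 0 < u) (β : ℂ) :
    ‖((1:ℂ)+u)^(-β)‖ = (1+u)^(-β.re) := by
  have : ((1:ℂ)+u) = ((1+u : ℝ) : ℂ) := by push_cast; rfl
  rw [this, norm_cpow_eq_rpow_re_of_pos (by positivity)]; simp

lemma LL_diff {ν : ℂ} (hν : 0 < ν.re) : DifferentiableOn ℂ (LL ν) {q | 0 < q.re} := by
  refine lap_diff (meas_cpow _).aestronglyMeasurable fun δ hδ => ?_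
  refine (rI hν hδ).congr_fun (fun t ht => ?_) measurableSet_Ioi
  dsimp only
  rw [norm_cpow_eq_rpow_re_of_pos ht]; simp

lemma KK_diff {ν β : ℂ} (hν : 0 < ν.re) (hβ : 0 < β.re) :
    DifferentiableOn ℂ (KK ν β) {q | 0 < q.re} := by
  refine lap_diff (by fun_prop) fun δ hδ => ?_
  refine Integrable.mono' (rI hν hδ) (by fun_prop) ?_
  filter_upwards [ae_restrict_mem measurableSet_Ioi] with t ht
  have ht : 0 < t := ht
  rw [norm_mul, norm_norm, norm_mul, norm_cpow_eq_rpow_re_of_pos ht, norm_one_add_cpow ht,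
    Real.norm_of_nonneg (Real.exp_pos _).le]
  have : (1+t)^(-β.re) ≤ 1 := Real.rpow_le_one_of_one_le_of_nonpos (by linarith) (by linarith)
  have h2 : 0 ≤ t ^ ((ν-1).re) := by positivity
  calc _ ≤ t ^ ((ν-1).re) * 1 * Real.exp (-(δ*t)) := by gcongr
    _ = _ := by simp

lemma LL_bound {ν p : ℂ} (hν : 0 < ν.re) (hp : 0 < p.re) {s : ℝ} (hs : 0 < s) :
    ‖LL ν (s + p)‖ ≤ ∫ t in Ioi (0:ℝ), t^(ν.re-1) * Real.exp (-(p.re*t)) := by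
  refine norm_integral_le_of_norm_le (rI hν hp) ?_
  filter_upwards [ae_restrict_mem measurableSet_Ioi] with t ht
  have ht : 0 < t := ht
  rw [norm_mul, norm_cpow_eq_rpow_re_of_pos ht, norm_exp]
  have : (-((s + p) * (t:ℂ))).re ≤ -(p.re * t) := by
    simp; nlinarith
  have h2 : 0 ≤ t ^ ((ν-1).re) := by positivity
  calc _ ≤ t ^ ((ν-1).re) * Real.exp (-(p.re*t)) := by gcongr
    _ = _ := by simp

/-- double integrand is integrable -/
lemma dbl_int {ν β p q : ℂ} (hν : 0 < ν.re) (hβ : 0 < β.re) (hp : 0 < p.re) (hq : 0 < q.re) :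
    Integrable (Function.uncurry fun s t : ℝ => ((s:ℂ)^(β-1) * cexp (-(q*s))) * ((t:ℂ)^(ν-1) * cexp (-(p*t)))
      * cexp (-(s*t))) ((volume.restrict (Ioi (0:ℝ))).prod (volume.restrict (Ioi (0:ℝ)))) := by
  have h := Integrable.mul_prod (cI hβ hq) (cI hν hp)
  refine h.mul_bdd (c := 1) (g := fun x : ℝ × ℝ => cexp (-(x.1 * x.2))) (by fun_prop) ?_
  rw [Measure.prod_restrict]
  filter_upwards [ae_restrict_mem (measurableSet_Ioi.prod measurableSet_Ioi)] with x hx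
  rw [norm_exp, Real.exp_le_one_iff]
  have h1 : 0 < x.1 := hx.1
  have h2 : 0 < x.2 := hx.2
  simp; positivity

lemma key_real {ν β p : ℂ} (hν : 0 < ν.re) (hβ : 0 < β.re) (hp : 0 < p.re) {q : ℝ} (hq : 0 < q) :
    ∫ s in Ioi (0:ℝ), ((s:ℂ)^(β-1) * LL ν (s + p)) * cexp (-(q*s)) =
      Complex.Gamma β * (q:ℂ)^(ν-β) * KK ν β (p*q) := by
  have hsw := integral_integral_swap (dbl_int (q := (q:ℂ)) hν hβ hp (by simpa using hq))
  have e1 : ∀ s : ℝ, ((s:ℂ)^(β-1) * LL ν (s + p)) * cexp (-(q*s)) =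
      ∫ t in Ioi (0:ℝ), ((s:ℂ)^(β-1) * cexp (-(q*s))) * ((t:ℂ)^(ν-1) * cexp (-(p*t)))
      * cexp (-(s*t)) := by
    intro s
    rw [LL, mul_right_comm, ← integral_const_mul]
    congr 1; ext t
    rw [show -((s+p)*(t:ℂ)) = -(p*t) + -(s*t) by ring, Complex.exp_add]
    ring
  simp_rw [e1]
  rw [hsw]
  have e2 : ∀ t ∈ Ioi (0:ℝ), (∫ s in Ioi (0:ℝ), ((s:ℂ)^(β-1) * cexp (-(q*s))) * ((t:ℂ)^(ν-1) * cexp (-(p*t)))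
      * cexp (-(s*t))) = Complex.Gamma β * ((t:ℂ)^(ν-1) * ((q:ℂ)+t)^(-β) * cexp (-(p*t))) := by
    intro t ht
    have ht : 0 < t := ht
    have hqt : 0 < q + t := by positivity
    have := Complex.integral_cpow_mul_exp_neg_mul_Ioi hβ hqt
    have h3 : (1 / ((q+t:ℝ):ℂ))^β = ((q:ℂ)+t)^(-β) := by
      rw [one_div, inv_cpow _ _ (by rw [arg_ofReal_of_nonneg hqt.le]; exact Real.pi_pos.ne), cpow_neg]
      push_cast; rfl
    rw [h3] at this
    rw [show Complex.Gamma β * ((t:ℂ)^(ν-1) * ((q:ℂ)+t)^(-β) * cexp (-(p*t))) =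
      ((t:ℂ)^(ν-1) * cexp (-(p*t))) * (((q:ℂ)+t)^(-β) * Complex.Gamma β) by ring, ← this,
      ← integral_const_mul]
    congr 1; ext s
    push_cast
    rw [show -((q+t:ℂ)*s) = -(q*s) + -(s*t) by ring, Complex.exp_add]
    ring
  rw [setIntegral_congr_fun measurableSet_Ioi e2, integral_const_mul, mul_assoc]
  congr 1
  have := integral_comp_mul_left_Ioi (fun t : ℝ => (t:ℂ)^(ν-1) * ((q:ℂ)+t)^(-β) * cexp (-(p*t))) 0 hq
  rw [mul_zero] at this
  have hq0 : (q:ℂ) ≠ 0 := by exact_mod_cast hq.ne'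
  have h5 : (∫ t in Ioi (0:ℝ), (t:ℂ)^(ν-1) * ((q:ℂ)+t)^(-β) * cexp (-(p*t))) = q * 
    ∫ x in Ioi (0:ℝ), ((q*x:ℝ):ℂ)^(ν-1) * ((q:ℂ)+(q*x:ℝ))^(-β) * cexp (-(p*(q*x:ℝ))) := by
    rw [this, real_smul, ← mul_assoc]; push_cast
    rw [mul_inv_cancel₀ hq0, one_mul]
  rw [h5, KK, ← integral_const_mul, ← integral_const_mul]
  refine setIntegral_congr_fun measurableSet_Ioi fun x hx => ?_
  have hx : 0 < x := hx
  have h6 : ((q:ℂ)+(q*x:ℝ)) = (q:ℂ) * ((1+x:ℝ):ℂ) := by push_cast; ring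
  rw [h6, mul_cpow_ofReal_nonneg hq.le (by positivity), ofReal_mul, mul_cpow_ofReal_nonneg hq.le hx.le]
  have h7 : (q:ℂ)^(ν-β) = q * (q:ℂ)^(ν-1) * (q:ℂ)^(-β) := by
    rw [mul_assoc, ← cpow_add _ _ hq0]
    nth_rewrite 2 [← cpow_one (q:ℂ)]
    rw [← cpow_add _ _ hq0]; ring_nf
  rw [h7]; push_cast; ring_nf

lemma key_cplx {ν β p : ℂ} (hν : 0 < ν.re) (hβ : 0 < β.re) (hp : 0 < p.re) {q : ℂ} (hq : 0 < q.re)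
    (hpq : 0 < (p*q).re) :
    ∫ s in Ioi (0:ℝ), ((s:ℂ)^(β-1) * LL ν (s + p)) * cexp (-(q*s)) =
      Complex.Gamma β * q^(ν-β) * KK ν β (p*q) := by
  set U : Set ℂ := {q | 0 < q.re} ∩ {q | 0 < (p*q).re} with hU
  have hUo : IsOpen U := (isOpen_lt continuous_const Complex.continuous_re).inter
    (isOpen_lt continuous_const (by fun_prop))
  have hUc : Convex ℝ U := by
    intro x hx y hy a b ha hb hab
    have hx1 : 0 < x.re := hx.1
    have hx2 : 0 < (p*x).re := hx.2
    have hy1 : 0 < y.re := hy.1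
    have hy2 : 0 < (p*y).re := hy.2
    have key : ∀ X Y : ℝ, 0 < X → 0 < Y → 0 < a * X + b * Y := by
      intro X Y hX hY
      rcases ha.eq_or_lt with h | h
      · have : b = 1 := by linarith
        rw [← h, this]; linarith
      · have := mul_pos h hX
        have := mul_nonneg hb hY.le
        linarith
    refine ⟨?_, ?_⟩
    · show 0 < (a • x + b • y).re
      simpa using key _ _ hx1 hy1
    · show 0 < (p * (a • x + b • y)).re
      have : p * (a • x + b • y) = a • (p*x) + b • (p * y) := by
        simp only [real_smul]; ring
      rw [this]
      simpa using key _ _ hx2 hy2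
  have hcont : ContinuousOn (fun s : ℝ => LL ν (s + p)) (Ioi 0) := by
    refine (LL_diff hν).continuousOn.comp (by fun_prop) fun s hs => ?_
    have hs : 0 < s := hs
    show 0 < ((s:ℂ) + p).re
    simp; positivity
  have hf : DifferentiableOn ℂ (fun q : ℂ => ∫ s in Ioi (0:ℝ), ((s:ℂ)^(β-1) * LL ν (s + p)) * cexp (-(q*s))) U := by
    refine DifferentiableOn.mono (lap_diff ?_ ?_) inter_subset_left
    · exact (meas_cpow _).aestronglyMeasurable.mul (hcont.aestronglyMeasurable measurableSet_Ioi)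
    · intro δ hδ
      refine Integrable.mono' ((rI hβ hδ).const_mul
        (∫ t in Ioi (0:ℝ), t^(ν.re-1) * Real.exp (-(p.re*t)))) ?_ ?_
      · refine AEStronglyMeasurable.mul (AEStronglyMeasurable.norm ?_) (by fun_prop)
        exact (meas_cpow _).aestronglyMeasurable.mul (hcont.aestronglyMeasurable measurableSet_Ioi)
      · filter_upwards [ae_restrict_mem measurableSet_Ioi] with s hs
        have hs : 0 < s := hs
        have := LL_bound hν hp hs
        rw [norm_mul, norm_norm, norm_mul, norm_cpow_eq_rpow_re_of_pos hs,
          Real.norm_of_nonneg (Real.exp_pos _).le, sub_re, one_re, mul_comm (s ^ _), mul_assoc]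
        have h2 : 0 ≤ s ^ (β.re-1) := by positivity
        gcongr
  have hg : DifferentiableOn ℂ (fun q : ℂ => Complex.Gamma β * q^(ν-β) * KK ν β (p*q)) U := by
    refine DifferentiableOn.mul (DifferentiableOn.const_mul ?_ _) ?_
    · intro q hq
      refine DifferentiableAt.differentiableWithinAt ?_
      exact (differentiableAt_id).cpow_const (Or.inl hq.1)
    · exact (KK_diff hν hβ).comp (by fun_prop) fun q hq => hq.2
  have h1 : (1:ℂ) ∈ U := ⟨by show (0:ℝ) < (1:ℂ).re; simp, by show 0 < (p*1).re; simpa using hp⟩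
  refine (hf.analyticOnNhd hUo).eqOn_of_preconnected_of_frequently_eq (hg.analyticOnNhd hUo) hUc.isPreconnected h1 ?_
    ⟨hq, hpq⟩
  have ht : Filter.Tendsto (fun x : ℝ => (x:ℂ)) (nhdsWithin 1 {1}ᶜ) (nhdsWithin 1 {1}ᶜ) := by
    refine tendsto_nhdsWithin_iff.2 ⟨?_, ?_⟩
    · have : Filter.Tendsto (fun x : ℝ => (x:ℂ)) (nhds 1) (nhds ((1:ℝ):ℂ)) := Complex.continuous_ofReal.tendsto 1
      rw [ofReal_one] at this
      exact this.mono_left nhdsWithin_le_nhds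
    · filter_upwards [self_mem_nhdsWithin] with x hx
      simpa using hx
  refine ht.frequently ?_
  refine Filter.Eventually.frequently ?_
  have : ∀ᶠ x : ℝ in nhdsWithin 1 {1}ᶜ, 0 < x := nhdsWithin_le_nhds (lt_mem_nhds one_pos)
  filter_upwards [this] with x hx
  exact key_real hν hβ hp hx

lemma beta_int {a b : ℝ} (ha : 0 < a) (hb : 0 ≤ b) (hab : a < b) :
    IntegrableOn (fun u : ℝ => u^(a-1) * (1+u)^(-b)) (Ioi 0) := by
  rw [← Ioc_union_Ioi_eq_Ioi (zero_le_one (α := ℝ)), integrableOn_union]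
  have hm : Measurable (fun u : ℝ => u^(a-1) * (1+u)^(-b)) := by fun_prop
  constructor
  · have h := (intervalIntegral.intervalIntegrable_rpow' (a := 0) (b := 1) (r := a-1) (by linarith)).1
    refine Integrable.mono' h hm.aestronglyMeasurable ?_
    filter_upwards [ae_restrict_mem measurableSet_Ioc] with u hu
    have h0 : 0 < u := hu.1
    rw [Real.norm_of_nonneg (by positivity)]
    have : (1+u)^(-b) ≤ 1 := Real.rpow_le_one_of_one_le_of_nonpos (by linarith) (by linarith)
    exact mul_le_of_le_one_right (by positivity) this
  · have h := integrableOn_Ioi_rpow_of_lt (a := a-1-b) (by linarith) one_pos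
    refine Integrable.mono' h hm.aestronglyMeasurable ?_
    filter_upwards [ae_restrict_mem measurableSet_Ioi] with u hu
    have h1 : 1 < u := hu
    have h0 : 0 < u := by linarith
    rw [Real.norm_of_nonneg (by positivity), sub_eq_add_neg (a-1) b, Real.rpow_add h0]
    gcongr ?_ * ?_
    exact Real.rpow_le_rpow_of_nonpos h0 (by linarith) (by linarith)

lemma KK_bound {ν β : ℂ} (hβ : 0 < β.re) {c : ℝ} (hc : 0 < c) (hca : c < ν.re)
    (hcb : ν.re - β.re < c) : ∃ C : ℝ, 0 ≤ C ∧ ∀ r : ℝ, 0 < r → ‖KK ν β r‖ ≤ C * r^(-c) := by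
  have hI := beta_int (a := ν.re - c) (b := β.re) (by linarith) hβ.le (by linarith)
  refine ⟨∫ u in Ioi (0:ℝ), c^c * (u^(ν.re - c - 1) * (1+u)^(-β.re)), ?_, ?_⟩
  · refine setIntegral_nonneg measurableSet_Ioi fun u hu => ?_
    have hu : 0 < u := hu
    positivity
  intro r hr
  rw [← integral_mul_const]
  refine norm_integral_le_of_norm_le ((hI.const_mul _).mul_const _) ?_
  filter_upwards [ae_restrict_mem measurableSet_Ioi] with u hu
  have hu : 0 < u := hu
  rw [norm_mul, norm_mul, norm_cpow_eq_rpow_re_of_pos hu, norm_one_add_cpow hu, norm_exp]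
  have h1 : (-((r:ℂ) * u)).re = -(r*u) := by simp
  have h2 : Real.exp (-(r*u)) ≤ c^c * (r*u)^(-c) := by
    have hx : 0 < r * u := by positivity
    have h3 : (r*u)/c ≤ Real.exp (r*u/c) := by linarith [Real.add_one_le_exp (r*u/c)]
    have h4 := Real.rpow_le_rpow (by positivity) h3 hc.le
    rw [← Real.exp_mul, div_mul_cancel₀ _ hc.ne', Real.div_rpow hx.le hc.le, div_le_iff₀ (by positivity)] at h4
    rw [Real.exp_neg, Real.rpow_neg hx.le, ← div_eq_mul_inv, inv_le_comm₀ (Real.exp_pos _) (by positivity), inv_div,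
      div_le_iff₀ (by positivity)]
    exact h4
  rw [h1]
  calc _ ≤ u ^ (ν-1).re * (1+u)^(-β.re) * (c^c * (r*u)^(-c)) := by gcongr
    _ = _ := by
      rw [Real.mul_rpow hr.le hu.le, sub_re, one_re, show ν.re - c - 1 = (ν.re - 1) + (-c) by ring,
        Real.rpow_add hu]
      ring

lemma dbl_val {ν β p q : ℂ} (hν : 0 < ν.re) (hβ : 0 < β.re) (hp : 0 < p.re) (hq : 0 < q.re)
    (hpq : 0 < (p*q).re) :
    ∫ x : ℝ × ℝ, ((x.1:ℂ)^(β-1) * cexp (-(q*x.1))) * ((x.2:ℂ)^(ν-1) * cexp (-(p*x.2)))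
      * cexp (-(x.1*x.2)) ∂((volume.restrict (Ioi (0:ℝ))).prod (volume.restrict (Ioi (0:ℝ)))) =
      Complex.Gamma β * q^(ν-β) * KK ν β (p*q) := by
  rw [← key_cplx hν hβ hp hq hpq]
  have h := integral_prod _ (dbl_int hν hβ hp hq)
  simp only [Function.uncurry] at h
  rw [h]
  congr 1; ext s
  rw [LL, mul_right_comm, ← integral_const_mul]
  congr 1; ext t
  rw [show -((s+p)*(t:ℂ)) = -(p*t) + -(s*t) by ring, Complex.exp_add]
  ring

lemma gauss (w : ℂ) : ∫ y : ℝ, cexp (-(y:ℂ)^2/2 - w * y) = (Real.sqrt (2*Real.pi) : ℂ) * cexp (w^2/2) := by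
  have h := integral_cexp_quadratic (b := -1/2) (by norm_num) (-w) 0
  have h2 : ((Real.pi:ℂ) / -(-1/2))^(1/2:ℂ) = (Real.sqrt (2*Real.pi) : ℂ) := by
    rw [Real.sqrt_eq_rpow, Complex.ofReal_cpow (by positivity)]
    push_cast; congr 1; ring
  rw [h2] at h
  convert h using 2
  · ext y; ring_nf
  · ring_nf

lemma gauss_int (w : ℂ) : Integrable fun y : ℝ => cexp (-(y:ℂ)^2/2 - w * y) := by
  have h := integrable_cexp_quadratic (b := 1/2) (by norm_num) (-w) 0
  convert h using 2
  ring_nf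

lemma fub {ν β : ℂ} (z : ℂ) (hν : 0 < ν.re) (hβ : 0 < β.re) {ε : ℝ} (hε : 0 < ε) :
    (Real.sqrt (2*Real.pi) : ℂ) * (cexp (z^2/2) *
      ((∫ s in Ioi (0:ℝ), cexp (I * z * s - (s:ℂ)^2/2) * (s:ℂ)^(β-1) * cexp (-(ε*s))) *
      (∫ t in Ioi (0:ℝ), cexp (-I * z * t - (t:ℂ)^2/2) * (t:ℂ)^(ν-1) * cexp (-(ε*t))))) =
    Complex.Gamma β * ∫ y : ℝ, cexp (-(y:ℂ)^2/2 - z * y) *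
      (((ε:ℂ) + I * y)^(ν-β) * KK ν β ((ε^2+y^2:ℝ):ℂ)) := by
  have hε' : 0 < (ε:ℂ).re := by simpa using hε
  have hG := (dbl_int (q := ε) (p := ε) hν hβ hε' hε').mul_prod (gauss_int z)
  have hG2 := hG.mul_bdd (c := 1) (g := fun x : (ℝ × ℝ) × ℝ => cexp (I * (x.1.2 - x.1.1) * x.2)) (by fun_prop)
    (Filter.Eventually.of_forall fun x => by rw [norm_exp]; simp)
  have hsw := integral_integral_swap (f := fun (x : ℝ × ℝ) (y : ℝ) => (((x.1:ℂ)^(β-1) * cexp (-(ε*x.1))) * ((x.2:ℂ)^(ν-1) * cexp (-(ε*x.2)))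
      * cexp (-(x.1*x.2))) * cexp (-(y:ℂ)^2/2 - z * y) * cexp (I * (x.2 - x.1) * y)) hG2
  have e1 : ∀ x : ℝ × ℝ, (∫ y : ℝ, (((x.1:ℂ)^(β-1) * cexp (-(ε*x.1))) * ((x.2:ℂ)^(ν-1) * cexp (-(ε*x.2)))
      * cexp (-(x.1*x.2))) * cexp (-(y:ℂ)^2/2 - z * y) * cexp (I * (x.2 - x.1) * y)) = 
      ((Real.sqrt (2*Real.pi) : ℂ) * cexp (z^2/2)) * ((cexp (I * z * x.1 - (x.1:ℂ)^2/2) * (x.1:ℂ)^(β-1) * cexp (-(ε*x.1))) *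
        (cexp (-I * z * x.2 - (x.2:ℂ)^2/2) * (x.2:ℂ)^(ν-1) * cexp (-(ε*x.2)))) := by
    intro x
    have := gauss (z - I * (x.2 - x.1))
    have e : ∀ y : ℝ, cexp (-(y:ℂ)^2/2 - (z - I * (x.2 - x.1)) * y) = 
        cexp (-(y:ℂ)^2/2 - z * y) * cexp (I * (x.2 - x.1) * y) := by
      intro y; rw [← Complex.exp_add]; ring_nf
    simp_rw [e] at this
    simp_rw [mul_assoc _ (cexp (-(_:ℂ)^2/2 - z * _))]
    rw [integral_const_mul, this]
    have e3 : cexp ((z - I * (x.2 - x.1))^2/2) * cexp (-(x.1*x.2)) = 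
      cexp (z^2/2) * cexp (I * z * x.1 - (x.1:ℂ)^2/2) * cexp (-I * z * x.2 - (x.2:ℂ)^2/2) := by
      simp_rw [← Complex.exp_add]
      congr 1
      linear_combination (x.2 - x.1 : ℂ)^2/2 * I_sq
    linear_combination ((x.1:ℂ)^(β-1) * cexp (-(ε*x.1))) * ((x.2:ℂ)^(ν-1) * cexp (-(ε*x.2))) * (Real.sqrt (2*Real.pi) : ℂ) * e3
  simp_rw [e1] at hsw
  rw [integral_const_mul, integral_prod_mul (fun s : ℝ => cexp (I * z * s - (s:ℂ)^2/2) * (s:ℂ)^(β-1) * cexp (-(ε*s)))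
    (fun t : ℝ => cexp (-I * z * t - (t:ℂ)^2/2) * (t:ℂ)^(ν-1) * cexp (-(ε*t)))] at hsw
  rw [← mul_assoc, hsw, ← integral_const_mul]
  congr 1; ext y
  have hp : 0 < ((ε:ℂ) - I * y).re := by simpa using hε
  have hq : 0 < ((ε:ℂ) + I * y).re := by simpa using hε
  have hpq : ((ε:ℂ) - I * y) * ((ε:ℂ) + I * y) = ((ε^2+y^2:ℝ):ℂ) := by
    push_cast; linear_combination -(y:ℂ)^2 * I_sq
  have := dbl_val hν hβ hp hq (by rw [hpq, ofReal_re]; positivity)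
  rw [hpq] at this
  rw [show Complex.Gamma β * (cexp (-(y:ℂ)^2/2 - z * y) *
      (((ε:ℂ) + I * y)^(ν-β) * KK ν β ((ε^2+y^2:ℝ):ℂ))) = cexp (-(y:ℂ)^2/2 - z * y) * (Complex.Gamma β *
      ((ε:ℂ) + I * y)^(ν-β) * KK ν β ((ε^2+y^2:ℝ):ℂ)) by ring, ← this, ← integral_const_mul]
  congr 1; ext x
  have e4 : cexp (-(((ε:ℂ) + I * y) * x.1)) * cexp (-(((ε:ℂ) - I * y) * x.2)) = 
    cexp (-(ε * x.1)) * cexp (-(ε*x.2)) * cexp (I * (x.2 - x.1) * y) := by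
    simp_rw [← Complex.exp_add]
    ring_nf
  linear_combination -cexp (-(y:ℂ)^2/2 - z * y) * (x.1:ℂ)^(β-1) * (x.2:ℂ)^(ν-1) * cexp (-(x.1*x.2)) * e4

lemma int_abs {f : ℝ → ℝ} (h : IntegrableOn f (Ioi 0)) : Integrable (fun y : ℝ => f |y|) := by
  have hr : IntegrableOn (fun y : ℝ => f |y|) (Ioi 0) :=
    h.congr_fun (fun y hy => by rw [abs_of_pos hy]) measurableSet_Ioi
  rw [← integrableOn_univ, ← @Iio_union_Ici _ _ (0 : ℝ), integrableOn_union,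
    integrableOn_Ici_iff_integrableOn_Ioi]
  refine ⟨?_, hr⟩
  rw [← (Measure.measurePreserving_neg (volume : Measure ℝ)).integrableOn_comp_preimage
      (Homeomorph.neg ℝ).measurableEmbedding]
  have : (Neg.neg ⁻¹' Iio (0:ℝ)) = Ioi 0 := by ext; simp
  rw [this]
  refine hr.congr_fun (fun y hy => by simp) measurableSet_Ioi

lemma half_int (w : ℂ) {a : ℂ} (ha : 0 < a.re) :
    IntegrableOn (fun s : ℝ => cexp (w * s - (s:ℂ)^2/2) * (s:ℂ)^(a-1)) (Ioi 0) := by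
  refine Integrable.mono' ((rI ha one_pos).const_mul (Real.exp ((w.re+1)^2/2))) (by fun_prop) ?_
  filter_upwards [ae_restrict_mem measurableSet_Ioi] with s hs
  have hs : 0 < s := hs
  rw [norm_mul, norm_cpow_eq_rpow_re_of_pos hs, norm_exp]
  have h1 : (w * s - (s:ℂ)^2/2).re = w.re * s - s^2/2 := by
    have : (s:ℂ)^2/2 = ((s^2/2 : ℝ):ℂ) := by push_cast; rfl
    rw [this, sub_re, ofReal_re]; simp
  have h2 : Real.exp (w.re * s - s^2/2) ≤ Real.exp ((w.re+1)^2/2) * Real.exp (-(1*s)) := by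
    rw [← Real.exp_add, Real.exp_le_exp]; nlinarith [sq_nonneg (w.re + 1 - s)]
  rw [h1]
  calc _ ≤ (Real.exp ((w.re+1)^2/2) * Real.exp (-(1*s))) * s^((a-1).re) := by gcongr
    _ = _ := by rw [sub_re, one_re]; ring

lemma half_lim {f : ℝ → ℂ} (hf : IntegrableOn f (Ioi 0)) :
    Filter.Tendsto (fun ε : ℝ => ∫ s in Ioi (0:ℝ), f s * cexp (-(ε*s))) (nhdsWithin 0 (Ioi 0))
      (nhds (∫ s in Ioi (0:ℝ), f s)) := by
  refine tendsto_integral_filter_of_dominated_convergence (fun s => ‖f s‖) ?_ ?_ hf.norm ?_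
  · exact Filter.Eventually.of_forall fun ε => hf.1.mul (by fun_prop)
  · filter_upwards [self_mem_nhdsWithin] with ε hε
    filter_upwards [ae_restrict_mem measurableSet_Ioi] with s hs
    have hs : 0 < s := hs
    have hε : 0 < ε := hε
    rw [norm_mul, norm_exp]
    refine mul_le_of_le_one_right (norm_nonneg _) ?_
    rw [Real.exp_le_one_iff]; simp; positivity
  · refine Filter.Eventually.of_forall fun s => ?_
    have : Continuous fun ε : ℝ => f s * cexp (-(ε*s)) := by fun_prop
    have h := this.tendsto 0
    simp only [ofReal_zero, zero_mul, neg_zero, Complex.exp_zero, mul_one] at h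
    exact h.mono_left nhdsWithin_le_nhds

lemma FF_bound {ν β : ℂ} (z : ℂ) (hν : 0 < ν.re) (hβ : 0 < β.re) (h1 : -1 < (ν-β).re) (h2 : (ν-β).re < 1) :
    ∃ B : ℝ → ℝ, Integrable B ∧ ∀ ε : ℝ, ∀ y : ℝ, y ≠ 0 → 
      ‖cexp (-(y:ℂ)^2/2 - z * y) * (((ε:ℂ) + I * y)^(ν-β) * KK ν β ((ε^2+y^2:ℝ):ℂ))‖ ≤ B y := by
  set d := (ν-β).re with hd
  have hd' : d = ν.re - β.re := by simp [hd]
  obtain ⟨c, hc1, hc2⟩ : ∃ c, max 0 d < c ∧ c < min ν.re ((d+1)/2) := by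
    refine exists_between (max_lt (lt_min hν (by linarith)) (lt_min (by linarith) (by linarith)))
  rw [max_lt_iff] at hc1
  rw [lt_min_iff] at hc2
  obtain ⟨C, hC0, hC⟩ := KK_bound (ν := ν) hβ hc1.1 hc2.1 (by linarith)
  have hI := int_abs (rI (a := d - 2*c + 1) (p := 1) (by linarith) one_pos)
  refine ⟨_, hI.const_mul (Real.exp ((|z.re|+1)^2/2) * Real.exp (Real.pi * |(ν-β).im|) * C), ?_⟩
  intro ε y hy
  have hr : 0 < ε^2+y^2 := by positivity
  rw [norm_mul, norm_mul, norm_exp]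
  have e1 : (-(y:ℂ)^2/2 - z * y).re = -y^2/2 - z.re * y := by
    have : -(y:ℂ)^2/2 = ((-y^2/2 : ℝ):ℂ) := by push_cast; rfl
    rw [this, sub_re, ofReal_re]; simp
  have e2 : Real.exp (-y^2/2 - z.re * y) ≤ Real.exp ((|z.re|+1)^2/2) * Real.exp (-(1*|y|)) := by
    rw [← Real.exp_add, Real.exp_le_exp]
    have a1 : -(z.re * y) ≤ |z.re| * |y| := by rw [← abs_mul]; exact neg_le_abs _
    nlinarith [sq_nonneg (|z.re| + 1 - |y|), sq_abs y]
  have e3 : ‖((ε:ℂ) + I * y)^(ν-β)‖ ≤ (ε^2+y^2)^(d/2) * Real.exp (Real.pi * |(ν-β).im|) := by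
    refine (norm_cpow_le _ _).trans ?_
    have : ‖(ε:ℂ) + I * y‖ = (ε^2+y^2)^(1/2:ℝ) := by
      rw [← Real.sqrt_eq_rpow, mul_comm I, Complex.norm_add_mul_I]
    rw [this, ← Real.rpow_mul hr.le, ← hd, one_div_mul_eq_div, div_eq_mul_inv, ← Real.exp_neg]
    gcongr
    have := Complex.abs_arg_le_pi ((ε:ℂ) + I * y)
    calc _ ≤ |arg ((ε:ℂ) + I * y) * (ν-β).im| := neg_le_abs _
      _ = |arg ((ε:ℂ) + I * y)| * |(ν-β).im| := abs_mul _ _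
      _ ≤ _ := by gcongr
  have e4 : (ε^2+y^2)^(d/2) * (ε^2+y^2)^(-c) ≤ |y|^(d-2*c+1-1) := by
    rw [← Real.rpow_add hr]
    have : |y|^(d-2*c+1-1) = (y^2)^(d/2+-c) := by
      rw [← sq_abs, ← Real.rpow_natCast, ← Real.rpow_mul (abs_nonneg _)]
      congr 1; push_cast; ring
    rw [this]
    exact Real.rpow_le_rpow_of_nonpos (by positivity) (by nlinarith) (by linarith [hc1.1, hc1.2])
  rw [e1]
  calc _ ≤ (Real.exp ((|z.re|+1)^2/2) * Real.exp (-(1*|y|))) * 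
        (((ε^2+y^2)^(d/2) * Real.exp (Real.pi * |(ν-β).im|)) * (C * (ε^2+y^2)^(-c))) := by
        gcongr
        exact hC _ hr
    _ = (Real.exp ((|z.re|+1)^2/2) * Real.exp (Real.pi * |(ν-β).im|) * C * Real.exp (-(1*|y|))) * 
        ((ε^2+y^2)^(d/2) * (ε^2+y^2)^(-c)) := by ring
    _ ≤ (Real.exp ((|z.re|+1)^2/2) * Real.exp (Real.pi * |(ν-β).im|) * C * Real.exp (-(1*|y|))) * 
        |y|^(d-2*c+1-1) := by gcongr
    _ = _ := by ring

lemma FF_cont {ν β : ℂ} (z : ℂ) (hν : 0 < ν.re) (hβ : 0 < β.re) {ε y : ℝ} (hy : y ≠ 0) (hε : 0 ≤ ε) :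
    ContinuousAt (fun x : ℝ × ℝ => cexp (-(x.2:ℂ)^2/2 - z * x.2) *
      (((x.1:ℂ) + I * x.2)^(ν-β) * KK ν β ((x.1^2+x.2^2:ℝ):ℂ))) (ε, y) := by
  refine ContinuousAt.mul (by fun_prop) (ContinuousAt.mul ?_ ?_)
  · refine ContinuousAt.cpow (by fun_prop) (by fun_prop) ?_
    right
    simpa using hy
  · have : ContinuousAt (KK ν β) ((ε^2+y^2:ℝ):ℂ) := by
      refine (KK_diff hν hβ).continuousOn.continuousAt
        ((isOpen_lt continuous_const Complex.continuous_re).mem_nhds ?_)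
      show 0 < (((ε^2+y^2:ℝ):ℂ)).re
      rw [ofReal_re]; positivity
    refine ContinuousAt.comp (f := fun x : ℝ × ℝ => ((x.1^2+x.2^2:ℝ):ℂ)) (g := KK ν β) this ?_
    fun_prop

lemma FF_meas {ν β : ℂ} (z : ℂ) (hν : 0 < ν.re) (hβ : 0 < β.re) {ε : ℝ} (hε : 0 ≤ ε) :
    AEStronglyMeasurable (fun y : ℝ => cexp (-(y:ℂ)^2/2 - z * y) *
      (((ε:ℂ) + I * y)^(ν-β) * KK ν β ((ε^2+y^2:ℝ):ℂ))) volume := by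
  have hc : ContinuousOn (fun y : ℝ => cexp (-(y:ℂ)^2/2 - z * y) *
      (((ε:ℂ) + I * y)^(ν-β) * KK ν β ((ε^2+y^2:ℝ):ℂ))) {0}ᶜ := by
    intro y hy
    refine ContinuousAt.continuousWithinAt ?_
    exact ContinuousAt.comp (f := fun y : ℝ => (ε, y)) (FF_cont z hν hβ hy hε) (by fun_prop)
  have := hc.aestronglyMeasurable (μ := volume) (measurableSet_singleton 0).compl
  rwa [restrict_compl_singleton] at this

lemma cpow_split {y : ℝ} (hy : 0 < y) {x : ℂ} (hx : x ≠ 0) (w : ℂ) : (x * y)^w = x^w * (y:ℂ)^w := by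
  have hy' : (y:ℂ) ≠ 0 := by exact_mod_cast hy.ne'
  rw [mul_comm x, cpow_def_of_ne_zero (mul_ne_zero hy' hx), cpow_def_of_ne_zero hx, cpow_def_of_ne_zero hy',
    log_ofReal_mul hy hx, ofReal_log hy.le, ← Complex.exp_add]
  ring_nf

noncomputable def PP (ν β z : ℂ) : ℂ := ∫ x in Ioi (0:ℝ), (x:ℂ)^(ν-β) * cexp (-z * x - (x:ℂ)^2/2) * KK ν β ((x:ℂ)^2)

lemma A_val {ν β : ℂ} (z : ℂ) (hν : 0 < ν.re) (hβ : 0 < β.re) (h1 : -1 < (ν-β).re) (h2 : (ν-β).re < 1) :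
    (Real.sqrt (2*Real.pi) : ℂ) * (cexp (z^2/2) *
      ((∫ s in Ioi (0:ℝ), cexp (I * z * s - (s:ℂ)^2/2) * (s:ℂ)^(β-1)) *
      (∫ t in Ioi (0:ℝ), cexp (-I * z * t - (t:ℂ)^2/2) * (t:ℂ)^(ν-1)))) =
    Complex.Gamma β * (I^(ν-β) * PP ν β z + (-I)^(ν-β) * PP ν β (-z)) := by
  obtain ⟨B, hB, hBb⟩ := FF_bound z hν hβ h1 h2
  have hne : ∀ᵐ y : ℝ, y ≠ 0 := Measure.ae_ne volume 0
  have hlim := ((half_lim (half_int (I*z) hβ)).mul (half_lim (half_int (-I*z) hν))).const_mul (cexp (z^2/2)) |>.const_mul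
    (Real.sqrt (2*Real.pi) : ℂ)
  have hlim2 : Filter.Tendsto (fun ε : ℝ => ∫ y : ℝ, cexp (-(y:ℂ)^2/2 - z * y) *
      (((ε:ℂ) + I * y)^(ν-β) * KK ν β ((ε^2+y^2:ℝ):ℂ))) (nhdsWithin 0 (Ioi 0)) (nhds 
      (∫ y : ℝ, cexp (-(y:ℂ)^2/2 - z * y) *
      ((((0:ℝ):ℂ) + I * y)^(ν-β) * KK ν β (((0:ℝ)^2+y^2:ℝ):ℂ)))) := by
    refine tendsto_integral_filter_of_dominated_convergence B ?_ ?_ hB ?_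
    · filter_upwards [self_mem_nhdsWithin] with ε hε
      exact FF_meas z hν hβ (le_of_lt hε)
    · refine Filter.Eventually.of_forall fun ε => ?_
      filter_upwards [hne] with y hy
      exact hBb ε y hy
    · filter_upwards [hne] with y hy
      have : ContinuousAt (fun ε : ℝ => cexp (-(y:ℂ)^2/2 - z * y) *
        (((ε:ℂ) + I * y)^(ν-β) * KK ν β ((ε^2+y^2:ℝ):ℂ))) 0 := 
        ContinuousAt.comp (f := fun ε : ℝ => (ε, y)) (FF_cont z hν hβ hy le_rfl) (by fun_prop)
      exact this.tendsto.mono_left nhdsWithin_le_nhds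
  have heq := tendsto_nhds_unique_of_eventuallyEq hlim (hlim2.const_mul (Complex.Gamma β)) (by
    filter_upwards [self_mem_nhdsWithin] with ε hε
    exact fub z hν hβ hε)
  rw [heq]
  congr 1
  have hint : Integrable (fun y : ℝ => cexp (-(y:ℂ)^2/2 - z * y) *
      ((((0:ℝ):ℂ) + I * y)^(ν-β) * KK ν β (((0:ℝ)^2+y^2:ℝ):ℂ))) := by
    refine hB.mono' (FF_meas z hν hβ le_rfl) ?_
    filter_upwards [hne] with y hy
    exact hBb 0 y hy
  rw [← intervalIntegral.integral_Iic_add_Ioi (b := 0) hint.integrableOn hint.integrableOn, add_comm]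
  congr 1
  · rw [PP, ← integral_const_mul]
    refine setIntegral_congr_fun measurableSet_Ioi fun y hy => ?_
    have hy : 0 < y := hy
    simp only [ofReal_zero, zero_add]
    rw [cpow_split hy I_ne_zero, show -(y:ℂ)^2/2 - z * y = -z * y - (y:ℂ)^2/2 by ring]
    push_cast; ring_nf
  · have := integral_comp_neg_Ioi 0 (fun y : ℝ => cexp (-(y:ℂ)^2/2 - z * y) *
      ((((0:ℝ):ℂ) + I * y)^(ν-β) * KK ν β (((0:ℝ)^2+y^2:ℝ):ℂ)))
    rw [neg_zero] at this
    rw [← this, PP, ← integral_const_mul]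
    refine setIntegral_congr_fun measurableSet_Ioi fun y hy => ?_
    have hy : 0 < y := hy
    simp only [ofReal_zero, zero_add]
    rw [show I * ((-y:ℝ):ℂ) = (-I) * y by push_cast; ring, cpow_split hy (neg_ne_zero.2 I_ne_zero)]
    push_cast
    rw [show -(-(y:ℂ))^2/2 - z * -y = - -z * y - (y:ℂ)^2/2 by ring]
    ring_nf

/-- Theorem 2, eq. (19) with `a = 1`:
`(√2 sin(πμ)/√π) ∫₀^∞ x^(μ-1) e^(-zx - x²/2) Ψ(ν,μ;x²) dx
  = e^(iπμ/2) D₋ν(iz) D_(μ-ν-1)(-iz) + e^(-iπμ/2) D₋ν(-iz) D_(μ-ν-1)(iz)`,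
with Ψ and each D written via their integral representations. -/
theorem psi_laplace_transform_product_parabolic_cylinder
    (ν μ z : ℂ) (hν : 0 < ν.re) (hμ0 : 0 < μ.re) (hμ2 : μ.re < 2)
    (hμν : μ.re < ν.re + 1) :
    ((Real.sqrt 2 / Real.sqrt Real.pi : ℝ) : ℂ) * Complex.sin ((Real.pi : ℂ) * μ) *
      (∫ x in Ioi (0:ℝ), (x:ℂ) ^ (μ - 1) * Complex.exp (-z * x - (x:ℂ)^2 / 2) *
        ((1 / Complex.Gamma ν) *
          ∫ u in Ioi (0:ℝ), Complex.exp (-(x:ℂ)^2 * u) * (u:ℂ) ^ (ν - 1) *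
            ((1:ℂ) + (u:ℂ)) ^ (μ - ν - 1))) =
    (Complex.exp (z^2 / 2) / (Complex.Gamma ν * Complex.Gamma (ν + 1 - μ))) *
      (Complex.exp (Complex.I * (Real.pi : ℂ) * μ / 2) *
          (∫ t in Ioi (0:ℝ), Complex.exp (-Complex.I * z * t - (t:ℂ)^2 / 2) *
            (t:ℂ) ^ (ν - 1)) *
          (∫ s in Ioi (0:ℝ), Complex.exp (Complex.I * z * s - (s:ℂ)^2 / 2) *
            (s:ℂ) ^ (ν - μ)) +
        Complex.exp (-Complex.I * (Real.pi : ℂ) * μ / 2) *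
          (∫ t in Ioi (0:ℝ), Complex.exp (Complex.I * z * t - (t:ℂ)^2 / 2) *
            (t:ℂ) ^ (ν - 1)) *
          (∫ s in Ioi (0:ℝ), Complex.exp (-Complex.I * z * s - (s:ℂ)^2 / 2) *
            (s:ℂ) ^ (ν - μ))) := by
  set β : ℂ := ν + 1 - μ with hβd
  have hβ : 0 < β.re := by simp [hβd]; linarith
  have hd : ν - β = μ - 1 := by rw [hβd]; ring
  have hb1 : ν - μ = β - 1 := by rw [hβd]; ring
  have hb2 : μ - ν - 1 = -β := by rw [hβd]; ring
  have h1 : -1 < (ν-β).re := by rw [hd]; simp; linarith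
  have h2 : (ν-β).re < 1 := by rw [hd]; simp; linarith
  have hA := A_val z hν hβ h1 h2
  have hB := A_val (-z) hν hβ h1 h2
  have hP : (∫ x in Ioi (0:ℝ), (x:ℂ) ^ (μ - 1) * Complex.exp (-z * x - (x:ℂ)^2 / 2) *
        ((1 / Complex.Gamma ν) *
          ∫ u in Ioi (0:ℝ), Complex.exp (-(x:ℂ)^2 * u) * (u:ℂ) ^ (ν - 1) *
            ((1:ℂ) + (u:ℂ)) ^ (μ - ν - 1))) = (1 / Complex.Gamma ν) * PP ν β z := by
    rw [PP, ← integral_const_mul]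
    congr 1; ext x
    have : (∫ u in Ioi (0:ℝ), Complex.exp (-(x:ℂ)^2 * u) * (u:ℂ) ^ (ν - 1) *
            ((1:ℂ) + (u:ℂ)) ^ (μ - ν - 1)) = KK ν β ((x:ℂ)^2) := by
      rw [KK]
      congr 1; ext u
      rw [hb2, neg_mul]; ring
    rw [this, hd]; ring
  rw [hP, hb1]
  have hGν : Complex.Gamma ν ≠ 0 := Complex.Gamma_ne_zero_of_re_pos hν
  have hGβ : Complex.Gamma β ≠ 0 := Complex.Gamma_ne_zero_of_re_pos hβ
  rw [neg_neg, neg_sq, mul_neg, neg_mul_neg, ← neg_mul] at hB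
  have hI1 : (I:ℂ)^(ν-β) = -I * cexp (I * Real.pi * μ / 2) := by
    rw [hd, cpow_def_of_ne_zero I_ne_zero, log_I,
      show (Real.pi/2*I : ℂ) * (μ-1) = I * Real.pi * μ / 2 + -(Real.pi/2*I) by ring, Complex.exp_add,
      Complex.exp_neg, Complex.exp_pi_div_two_mul_I, inv_I]; ring
  have hI2 : (-I:ℂ)^(ν-β) = I * cexp (-I * Real.pi * μ / 2) := by
    rw [hd, cpow_def_of_ne_zero (neg_ne_zero.2 I_ne_zero), log_neg_I,
      show (-(Real.pi/2)*I : ℂ) * (μ-1) = -I * Real.pi * μ / 2 + (Real.pi/2*I) by ring, Complex.exp_add,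
      Complex.exp_pi_div_two_mul_I]; ring
  rw [hI1, hI2] at hA hB
  set E1 := cexp (I * Real.pi * μ / 2) with hE1
  set E2 := cexp (-I * Real.pi * μ / 2) with hE2
  have hE12 : E1 * E2 = 1 := by
    rw [hE1, hE2, ← Complex.exp_add, ← Complex.exp_zero]; ring_nf
  have hsin : 2 * Complex.sin ((Real.pi : ℂ) * μ) = -I * E1^2 + I * E2^2 := by
    rw [hE1, hE2, ← Complex.exp_nat_mul, ← Complex.exp_nat_mul, Complex.two_sin]
    push_cast; ring_nf
  set T1 := ∫ t in Ioi (0:ℝ), Complex.exp (-Complex.I * z * t - (t:ℂ)^2 / 2) * (t:ℂ) ^ (ν - 1)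
  set T2 := ∫ t in Ioi (0:ℝ), Complex.exp (Complex.I * z * t - (t:ℂ)^2 / 2) * (t:ℂ) ^ (ν - 1)
  set S1 := ∫ s in Ioi (0:ℝ), Complex.exp (Complex.I * z * s - (s:ℂ)^2 / 2) * (s:ℂ) ^ (β - 1)
  set S2 := ∫ s in Ioi (0:ℝ), Complex.exp (-Complex.I * z * s - (s:ℂ)^2 / 2) * (s:ℂ) ^ (β - 1)
  set R : ℂ := (Real.sqrt (2*Real.pi) : ℂ) with hR
  have hR0 : R ≠ 0 := by
    rw [hR]; exact_mod_cast (Real.sqrt_pos.2 (by positivity)).ne'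
  have hRR : R * ((Real.sqrt 2 / Real.sqrt Real.pi : ℝ) : ℂ) = 2 := by
    rw [hR, ← ofReal_mul, Real.sqrt_mul (by norm_num)]
    have : Real.sqrt Real.pi ≠ 0 := (Real.sqrt_pos.2 Real.pi_pos).ne'
    have h : Real.sqrt 2 * Real.sqrt Real.pi * (Real.sqrt 2 / Real.sqrt Real.pi) = 2 := by
      field_simp
      exact Real.sq_sqrt (by norm_num)
    rw [h]; norm_num
  set Q : ℂ := ((Real.sqrt 2 / Real.sqrt Real.pi : ℝ) : ℂ)
  have hsum : R * (cexp (z^2/2) * (E1 * T1 * S1 + E2 * T2 * S2)) =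
      Complex.Gamma β * (2 * Complex.sin ((Real.pi : ℂ) * μ) * PP ν β z) := by
    rw [hsin]
    linear_combination E1 * hA + E2 * hB
  apply mul_left_cancel₀ hR0
  have hr : R * (cexp (z^2/2) / (Complex.Gamma ν * Complex.Gamma β) * (E1 * T1 * S1 + E2 * T2 * S2)) =
      (R * (cexp (z^2/2) * (E1 * T1 * S1 + E2 * T2 * S2))) / (Complex.Gamma ν * Complex.Gamma β) := by ring
  rw [hr, hsum, eq_div_iff (mul_ne_zero hGν hGβ)]
  have hi : (1 / Complex.Gamma ν) * Complex.Gamma ν = 1 := by field_simp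
  linear_combination (Complex.sin ((Real.pi : ℂ) * μ) * PP ν β z * Complex.Gamma β) * hRR +
    (R * Q * Complex.sin ((Real.pi : ℂ) * μ) * PP ν β z * Complex.Gamma β) * hi
end

section
/- Let ν, μ, z ∈ ℂ with Re ν > 0, 0 < Re μ < 2 and Re μ < Re ν + 1. Then (e^(−z²/2)/(Γ(ν)·Γ(ν+1−μ))) · (∫₀^∞ e^(−z·t − t²/2) t^(ν−1) dt) · (∫₀^∞ e^(z·s − s²/2) s^(ν−μ) ds) = √(2/π) · ∫₀^∞ sin(z·x + πμ/2) · x^(μ−1) · e^(−x²/2) · ((1/Γ(ν)) ∫₀^∞ e^(−x²·u) u^(ν−1) (1+u)^(μ−ν−1) du) dx. (This is eq. (20) of Theorem 2 with a = 1: D₋ν(z)·D_(μ−ν−1)(−z) = (2/√(2π)) ∫₀^∞ sin(zx + πμ/2) x^(μ−1) e^(−x²/2) Ψ(ν,μ;x²) dx, written with Ψ and each D replaced by their integral representations.) -/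
open MeasureTheory Complex Set

open Filter Topology

noncomputable def pcM : Measure ℝ := volume.restrict (Ioi (0:ℝ))

instance : SFinite pcM := by unfold pcM; infer_instance

noncomputable def pcE (α β p q : ℂ) (v : ℝ × ℝ) : ℂ :=
  cexp (-p * v.1 - q * v.2 - v.1 * v.2) * ((v.1:ℂ) ^ (α - 1) * (v.2:ℂ) ^ (β - 1))

lemma pc_ae : ∀ᵐ t ∂pcM, 0 < t := ae_restrict_mem measurableSet_Ioi

lemma pc_ae2 : ∀ᵐ v ∂(pcM.prod pcM), 0 < v.1 ∧ 0 < v.2 := by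
  have h1 : ∀ᵐ v ∂(pcM.prod pcM), 0 < v.1 := Measure.quasiMeasurePreserving_fst.ae pc_ae
  have h2 : ∀ᵐ v ∂(pcM.prod pcM), 0 < v.2 := Measure.quasiMeasurePreserving_snd.ae pc_ae
  filter_upwards [h1, h2] with v a b using ⟨a, b⟩

lemma pc_int1 {a ε : ℝ} (ha : 0 < a) (hε : 0 < ε) :
    Integrable (fun t : ℝ => t ^ (a - 1) * Real.exp (-ε * t)) pcM := by
  have := integrableOn_rpow_mul_exp_neg_mul_rpow (p := 1) (s := a - 1) (b := ε)
    (by linarith) one_pos hε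
  simpa [IntegrableOn, pcM] using this

lemma pcE_norm (α β p q : ℂ) (v : ℝ × ℝ) (h : 0 < v.1 ∧ 0 < v.2) :
    ‖pcE α β p q v‖ = Real.exp (-p.re * v.1 - q.re * v.2 - v.1 * v.2) *
      (v.1 ^ (α.re - 1) * v.2 ^ (β.re - 1)) := by
  unfold pcE
  rw [norm_mul, norm_mul, norm_cpow_eq_rpow_re_of_pos h.1, norm_cpow_eq_rpow_re_of_pos h.2,
    Complex.norm_exp]
  simp

lemma pcE_norm_le (α β p q : ℂ) {δ : ℝ} (hp : δ ≤ p.re) (hq : δ ≤ q.re) (v : ℝ × ℝ)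
    (h : 0 < v.1 ∧ 0 < v.2) :
    ‖pcE α β p q v‖ ≤ (v.1 ^ (α.re - 1) * Real.exp (-δ * v.1)) *
      (v.2 ^ (β.re - 1) * Real.exp (-δ * v.2)) := by
  rw [pcE_norm _ _ _ _ _ h]
  obtain ⟨h1, h2⟩ := h
  have : Real.exp (-p.re * v.1 - q.re * v.2 - v.1 * v.2) ≤
      Real.exp (-δ * v.1) * Real.exp (-δ * v.2) := by
    rw [← Real.exp_add, Real.exp_le_exp]
    nlinarith [mul_pos h1 h2, mul_nonneg (sub_nonneg.2 hp) h1.le,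
      mul_nonneg (sub_nonneg.2 hq) h2.le]
  have h3 : 0 ≤ v.1 ^ (α.re - 1) * v.2 ^ (β.re - 1) := by positivity
  nlinarith [mul_le_mul_of_nonneg_right this h3]

lemma pcE_meas (α β p q : ℂ) : Measurable (pcE α β p q) := by
  unfold pcE; fun_prop

lemma pcE_int {α β p q : ℂ} (hα : 0 < α.re) (hβ : 0 < β.re) (hp : 0 < p.re) (hq : 0 < q.re) :
    Integrable (pcE α β p q) (pcM.prod pcM) := by
  have hδ : 0 < min p.re q.re := lt_min hp hq
  refine ((pc_int1 hα hδ).mul_prod (pc_int1 hβ hδ)).mono' (pcE_meas _ _ _ _).aestronglyMeasurable ?_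
  filter_upwards [pc_ae2] with v hv
  exact pcE_norm_le _ _ _ _ (min_le_left _ _) (min_le_right _ _) v hv

lemma pc_diff {α β : ℂ} (hα : 0 < α.re) (hβ : 0 < β.re) {N : ℝ} (hN : 0 < N) {q₀ : ℂ}
    (hq₀ : 0 < q₀.re) :
    DifferentiableAt ℂ (fun q : ℂ => ∫ v, pcE α β (N / q) q v ∂(pcM.prod pcM)) q₀ := by
  have hq0 : q₀ ≠ 0 := by rintro rfl; simp at hq₀
  have hpos : 0 < ((N:ℂ) / q₀).re := by
    rw [div_re]; simp
    have : 0 < normSq q₀ := normSq_pos.2 hq0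
    positivity
  obtain ⟨δ, hδ, hδ1, hδ2⟩ : ∃ δ : ℝ, 0 < δ ∧ δ < q₀.re ∧ δ < ((N:ℂ) / q₀).re := by
    obtain ⟨δ, h1, h2⟩ := exists_between (lt_min hq₀ hpos)
    exact ⟨δ, h1, lt_of_lt_of_le h2 (min_le_left _ _), lt_of_lt_of_le h2 (min_le_right _ _)⟩
  have hc : ContinuousAt (fun q : ℂ => (N:ℂ) / q) q₀ := by fun_prop (disch := assumption)
  have hc2 : ContinuousAt (fun q : ℂ => ‖(N:ℂ) / q ^ 2‖) q₀ := by
    have : q₀ ^ 2 ≠ 0 := by positivity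
    fun_prop (disch := assumption)
  set K := ‖(N:ℂ) / q₀ ^ 2‖ + 1 with hK
  have hKpos : 1 ≤ K := by rw [hK]; linarith [norm_nonneg ((N:ℂ) / q₀ ^ 2)]
  have hs : {q : ℂ | δ < q.re ∧ δ < ((N:ℂ) / q).re ∧ ‖(N:ℂ) / q ^ 2‖ < K} ∈ 𝓝 q₀ := by
    have e1 : ∀ᶠ q : ℂ in 𝓝 q₀, δ < q.re :=
      (continuous_re.continuousAt).eventually (lt_mem_nhds hδ1)
    have e2 : ∀ᶠ q : ℂ in 𝓝 q₀, δ < ((N:ℂ) / q).re :=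
      ((continuous_re.continuousAt).comp hc).eventually (lt_mem_nhds hδ2)
    have e3 : ∀ᶠ q : ℂ in 𝓝 q₀, ‖(N:ℂ) / q ^ 2‖ < K :=
      hc2.eventually (gt_mem_nhds (by rw [hK]; linarith))
    filter_upwards [e1, e2, e3] with q a b c using ⟨a, b, c⟩
  have key := hasDerivAt_integral_of_dominated_loc_of_deriv_le (μ := pcM.prod pcM) (𝕜 := ℂ)
    (F := fun q v => pcE α β (N / q) q v)
    (F' := fun q v => ((N / q ^ 2) * v.1 - v.2) * pcE α β (N / q) q v)
    (bound := fun v => K * ((v.1 ^ (α.re + 1 - 1) * Real.exp (-δ * v.1)) *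
      (v.2 ^ (β.re - 1) * Real.exp (-δ * v.2)) + (v.1 ^ (α.re - 1) * Real.exp (-δ * v.1)) *
      (v.2 ^ (β.re + 1 - 1) * Real.exp (-δ * v.2)))) hs
    (Eventually.of_forall fun q => (pcE_meas _ _ _ _).aestronglyMeasurable)
    (pcE_int hα hβ hpos hq₀) ?_ ?_ ?_ ?_
  · exact key.2.differentiableAt
  · apply Measurable.aestronglyMeasurable
    have := pcE_meas α β (N / q₀) q₀
    fun_prop
  · filter_upwards [pc_ae2] with v hv q hq
    have hb := pcE_norm_le α β (N / q) q hq.2.1.le hq.1.le v hv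
    rw [norm_mul]
    have h1 : ‖(N / q ^ 2 * v.1 - v.2 : ℂ)‖ ≤ K * (v.1 + v.2) := by
      refine (norm_sub_le _ _).trans ?_
      rw [norm_mul, norm_real, norm_real, Real.norm_of_nonneg hv.1.le, Real.norm_of_nonneg hv.2.le]
      nlinarith [mul_le_mul_of_nonneg_right hq.2.2.le hv.1.le, hv.2]
    refine (mul_le_mul h1 hb (norm_nonneg _) (by nlinarith [hv.1, hv.2])).trans (le_of_eq ?_)
    have r1 : v.1 ^ (α.re + 1 - 1) = v.1 ^ (α.re - 1) * v.1 := by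
      rw [← Real.rpow_add_one hv.1.ne']; congr 1; ring
    have r2 : v.2 ^ (β.re + 1 - 1) = v.2 ^ (β.re - 1) * v.2 := by
      rw [← Real.rpow_add_one hv.2.ne']; congr 1; ring
    rw [r1, r2]; ring
  · refine Integrable.const_mul (Integrable.add ?_ ?_) _
    · exact (pc_int1 (by linarith) hδ).mul_prod (pc_int1 hβ hδ)
    · exact (pc_int1 hα hδ).mul_prod (pc_int1 (by linarith) hδ)
  · refine Eventually.of_forall fun v q hq => ?_
    have hq0 : q ≠ 0 := by
      rintro rfl
      have := hq.1; simp at this; linarith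
    unfold pcE
    have h1 : HasDerivAt (fun q : ℂ => -((N:ℂ) / q) * v.1 - q * v.2 - v.1 * v.2)
        ((N / q ^ 2) * v.1 - v.2) q := by
      have h2 : HasDerivAt (fun q : ℂ => (N:ℂ) / q) (-(N / q ^ 2)) q := by
        have := (hasDerivAt_inv hq0).const_mul (N:ℂ)
        refine (this.congr_deriv (by ring)).congr_of_eventuallyEq
          (Eventually.of_forall fun q => by simp [div_eq_mul_inv])
      have := ((h2.neg.mul_const (v.1:ℂ)).sub ((hasDerivAt_id q).mul_const (v.2:ℂ))).sub_const
        ((v.1:ℂ) * v.2)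
      refine (this.congr_deriv (by simp)).congr_of_eventuallyEq
          (Eventually.of_forall fun q => by simp)
    refine ( h1.cexp.mul_const ((v.1:ℂ) ^ (α - 1) * (v.2:ℂ) ^ (β - 1))).congr_deriv ?_
    ring

noncomputable def pcP (α β : ℂ) (w : ℝ) : ℂ :=
  ∫ u, cexp (-(w:ℂ) * u) * (u:ℂ) ^ (α - 1) * ((1:ℂ) + u) ^ (-β) ∂pcM

lemma pc_real {α β : ℂ} (hα : 0 < α.re) (hβ : 0 < β.re) {N : ℝ} (hN : 0 < N) {q : ℝ}
    (hq : 0 < q) :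
    ∫ v, pcE α β (N / q) q v ∂(pcM.prod pcM) = Complex.Gamma β * (q:ℂ) ^ (α - β) * pcP α β N := by
  have hpr : 0 < ((N:ℂ) / q).re := by rw [← ofReal_div, ofReal_re]; positivity
  rw [integral_prod _ (pcE_int hα hβ hpr (by simpa using hq))]
  have h1 : ∀ t : ℝ, 0 < t → ∫ s, pcE α β (N / q) q (t, s) ∂pcM =
      Complex.Gamma β * (cexp (-(N / q) * t) * (t:ℂ) ^ (α - 1) * ((t + q : ℝ) : ℂ) ^ (-β)) := by
    intro t ht
    have hr : 0 < t + q := by positivity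
    have := integral_cpow_mul_exp_neg_mul_Ioi hβ hr
    have e : ∀ s : ℝ, pcE α β (N / q) q (t, s) = (cexp (-(N / q) * t) * (t:ℂ) ^ (α - 1)) *
        ((s:ℂ) ^ (β - 1) * cexp (-(((t + q : ℝ):ℂ) * s))) := by
      intro s
      simp only [pcE]
      rw [show (-(N / q) * t - q * s - t * s : ℂ) =
        (-(N / q) * t) + (-(((t + q : ℝ):ℂ) * s)) by push_cast; ring, Complex.exp_add]
      ring
    simp_rw [e]
    rw [integral_const_mul, pcM, this, one_div, inv_cpow_ofReal_nonneg hr.le, cpow_neg]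
    ring
  have h2 : ∫ t, ∫ s, pcE α β (N / q) q (t, s) ∂pcM ∂pcM = ∫ t, 
      Complex.Gamma β * (cexp (-(N / q) * t) * (t:ℂ) ^ (α - 1) * ((t + q : ℝ) : ℂ) ^ (-β)) ∂pcM := by
    apply integral_congr_ae
    filter_upwards [pc_ae] with t ht using h1 t ht
  rw [h2, integral_const_mul, mul_assoc]
  congr 1
  have h3 := integral_comp_mul_left_Ioi' (fun t : ℝ =>
    (cexp (-(N / q) * t) * (t:ℂ) ^ (α - 1) * ((t + q : ℝ) : ℂ) ^ (-β))) 0 hq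
  rw [mul_zero] at h3
  rw [pcM, ← h3, pcP, real_smul, ← integral_const_mul, ← integral_const_mul]
  apply setIntegral_congr_fun measurableSet_Ioi
  intro u hu
  have hu : 0 < u := hu
  have hqc : (q:ℂ) ≠ 0 := by exact_mod_cast hq.ne'
  have e1 : (((q * u : ℝ) : ℂ)) ^ (α - 1) = (q:ℂ) ^ (α - 1) * (u:ℂ) ^ (α - 1) := by
    rw [ofReal_mul, mul_cpow_ofReal_nonneg hq.le hu.le]
  have e2 : (((q * u + q : ℝ) : ℂ)) ^ (-β) = (q:ℂ) ^ (-β) * ((1:ℂ) + u) ^ (-β) := by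
    rw [show q * u + q = q * (1 + u) by ring, ofReal_mul,
      mul_cpow_ofReal_nonneg hq.le (by positivity)]
    push_cast; rfl
  have e3 : (q:ℂ) ^ (α - β) = q * (q:ℂ) ^ (α - 1) * (q:ℂ) ^ (-β) := by
    rw [show α - β = 1 + (α - 1) + (-β) by ring, cpow_add _ _ hqc, cpow_add _ _ hqc, cpow_one]
  have e4 : (-((N:ℂ) / q) * (q * u : ℝ)) = -(N:ℂ) * u := by
    push_cast; field_simp
  simp only []
  rw [e1, e2, e3, e4]
  ring

lemma pc_key {α β : ℂ} (hα : 0 < α.re) (hβ : 0 < β.re) {N : ℝ} (hN : 0 < N) {q : ℂ}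
    (hq : 0 < q.re) :
    ∫ v, pcE α β (N / q) q v ∂(pcM.prod pcM) = Complex.Gamma β * q ^ (α - β) * pcP α β N := by
  have hU : IsOpen {q : ℂ | 0 < q.re} := isOpen_lt continuous_const continuous_re
  have hconv : IsPreconnected {q : ℂ | 0 < q.re} := (convex_halfSpace_re_gt 0).isPreconnected
  have hf : AnalyticOnNhd ℂ (fun q : ℂ => ∫ v, pcE α β (N / q) q v ∂(pcM.prod pcM))
      {q : ℂ | 0 < q.re} :=
    DifferentiableOn.analyticOnNhd
      (fun q hq => (pc_diff hα hβ hN hq).differentiableWithinAt) hU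
  have hg : AnalyticOnNhd ℂ (fun q : ℂ => Complex.Gamma β * q ^ (α - β) * pcP α β N)
      {q : ℂ | 0 < q.re} := by
    refine DifferentiableOn.analyticOnNhd (fun q hq => ?_) hU
    have : q ∈ slitPlane := Or.inl hq
    exact (((differentiableAt_id.cpow_const (c := α - β) this).const_mul _).mul_const
      _).differentiableWithinAt
  refine hf.eqOn_of_preconnected_of_frequently_eq hg hconv (z₀ := 1) (by simp) ?_ hq
  have ht : Tendsto (fun n : ℕ => ((1 + 1 / ((n:ℝ) + 1) : ℝ) : ℂ)) atTop (𝓝[≠] 1) := by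
    rw [tendsto_nhdsWithin_iff]
    constructor
    · have h := (tendsto_one_div_add_atTop_nhds_zero_nat (𝕜 := ℝ)).const_add 1
      rw [add_zero] at h
      have := (continuous_ofReal.tendsto 1).comp h
      simpa [Function.comp_def] using this
    · refine Eventually.of_forall fun n => ?_
      have : (0:ℝ) < 1 / ((n:ℝ) + 1) := by positivity
      simp only [mem_compl_iff, mem_singleton_iff]
      intro h
      have h' : (1 + 1 / ((n:ℝ) + 1) : ℝ) = 1 := by exact_mod_cast h
      linarith
  refine ht.frequently (Eventually.of_forall fun n => ?_).frequently
  exact pc_real hα hβ hN (by positivity)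
lemma pc_abs_int {κ : ℝ} (hκ : -1 < κ) :
    Integrable (fun x : ℝ => |x| ^ κ * Real.exp (-(1/4) * x ^ 2)) := by
  have h := integrableOn_rpow_mul_exp_neg_mul_sq (b := 1/4) (by norm_num) hκ
  rw [← integrable_indicator_iff measurableSet_Ioi] at h
  refine (h.add h.comp_neg).congr ?_
  have h0 : ∀ᵐ x : ℝ, x ≠ 0 := by simp [ae_iff]
  filter_upwards [h0] with x hx
  rcases lt_or_gt_of_ne hx with hx | hx
  · simp [indicator, hx, not_lt.2 hx.le, abs_of_neg hx]
  · simp [indicator, hx, not_lt.2 hx.le, abs_of_pos hx]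

lemma pc_beta_int {r b : ℝ} (hr : -1 < r) (hb : 0 < b) (hrb : r - b < -1) :
    Integrable (fun u : ℝ => u ^ r * (1 + u) ^ (-b)) pcM := by
  have hm : Measurable (fun u : ℝ => u ^ r * (1 + u) ^ (-b)) := by fun_prop
  unfold pcM
  rw [← Ioc_union_Ioi_eq_Ioi (zero_le_one' ℝ)]
  apply IntegrableOn.union
  · have h1 : IntegrableOn (fun u : ℝ => u ^ r) (Ioc 0 1) := by
      have := intervalIntegral.intervalIntegrable_rpow' (a := 0) (b := 1) hr
      rwa [intervalIntegrable_iff_integrableOn_Ioc_of_le zero_le_one] at this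
    refine Integrable.mono' h1 hm.aestronglyMeasurable ?_
    filter_upwards [ae_restrict_mem measurableSet_Ioc] with u hu
    have hu0 := hu.1
    rw [Real.norm_of_nonneg (by positivity)]
    have : (1 + u) ^ (-b) ≤ 1 := Real.rpow_le_one_of_one_le_of_nonpos (by linarith) (by linarith)
    have h3 : 0 ≤ u ^ r := by positivity
    nlinarith
  · have h1 := integrableOn_Ioi_rpow_of_lt hrb one_pos
    refine Integrable.mono' h1 hm.aestronglyMeasurable ?_
    filter_upwards [ae_restrict_mem measurableSet_Ioi] with u hu
    have hu0 : 0 < u := lt_trans one_pos hu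
    rw [Real.norm_of_nonneg (by positivity), sub_eq_add_neg, Real.rpow_add hu0]
    have : (1 + u) ^ (-b) ≤ u ^ (-b) :=
      Real.rpow_le_rpow_of_nonpos hu0 (by linarith) (by linarith)
    gcongr

lemma pcP_integrand_le (α β : ℂ) {a w u : ℝ} (ha0 : 0 ≤ a) (ha1 : a ≤ 1) (hw : 0 < w) (hu : 0 < u) :
    ‖cexp (-(w:ℂ) * u) * (u:ℂ) ^ (α - 1) * ((1:ℂ) + u) ^ (-β)‖ ≤
      w ^ (-a) * (u ^ (α.re - 1 - a) * (1 + u) ^ (-β.re)) := by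
  have h1u : 0 < 1 + u := by positivity
  rw [norm_mul, norm_mul, norm_cpow_eq_rpow_re_of_pos hu,
    show (1:ℂ) + u = ((1 + u : ℝ) : ℂ) by push_cast; rfl, norm_cpow_eq_rpow_re_of_pos h1u,
    Complex.norm_exp, Real.rpow_sub hu, Real.rpow_neg hw.le]
  simp only [sub_re, one_re, neg_re, mul_re, ofReal_re, ofReal_im, neg_im, mul_zero, sub_zero]
  have hwu : 0 < w * u := by positivity
  have key : (w * u) ^ a ≤ Real.exp (w * u) := by
    rcases le_total (w * u) 1 with h | h
    · exact (Real.rpow_le_one hwu.le h ha0).trans (Real.one_le_exp hwu.le)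
    · calc (w * u) ^ a ≤ (w * u) ^ (1:ℝ) := Real.rpow_le_rpow_of_exponent_le h ha1
        _ = w * u := Real.rpow_one _
        _ ≤ Real.exp (w * u) := by linarith [Real.add_one_le_exp (w * u)]
  have k2 : Real.exp (-w * u) ≤ (w ^ a)⁻¹ * (u ^ a)⁻¹ := by
    rw [← mul_inv, ← Real.mul_rpow hw.le hu.le, neg_mul, Real.exp_neg]
    exact inv_anti₀ (by positivity) key
  calc _ ≤ ((w ^ a)⁻¹ * (u ^ a)⁻¹) * u ^ (α.re - 1) * (1 + u) ^ (-β.re) := by gcongr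
    _ = _ := by ring

lemma pcP_meas (α β : ℂ) : Measurable (pcP α β) := by
  unfold pcP
  apply StronglyMeasurable.measurable
  apply StronglyMeasurable.integral_prod_right
  apply Measurable.stronglyMeasurable
  simp only [Function.uncurry_def]
  fun_prop

lemma pcP_cont {α β : ℂ} {a w : ℝ} (ha0 : 0 ≤ a) (ha1 : a ≤ 1) (hw : 0 < w)
    (hi : Integrable (fun u : ℝ => u ^ (α.re - 1 - a) * (1 + u) ^ (-β.re)) pcM) :
    ContinuousAt (pcP α β) w := by
  unfold pcP
  apply continuousAt_of_dominated (bound := fun u => (w/2) ^ (-a) *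
    (u ^ (α.re - 1 - a) * (1 + u) ^ (-β.re)))
  · refine Eventually.of_forall fun w => Measurable.aestronglyMeasurable ?_
    fun_prop
  · filter_upwards [lt_mem_nhds (show w / 2 < w by linarith)] with w' hw'
    filter_upwards [pc_ae] with u hu
    refine (pcP_integrand_le α β ha0 ha1 (by linarith) hu).trans ?_
    have : w' ^ (-a) ≤ (w / 2) ^ (-a) :=
      Real.rpow_le_rpow_of_nonpos (by linarith) hw'.le (by linarith)
    gcongr
  · exact hi.const_mul _
  · refine Eventually.of_forall fun u => ?_
    fun_prop

lemma pcP_le {α β : ℂ} {a w : ℝ} (ha0 : 0 ≤ a) (ha1 : a ≤ 1) (hw : 0 < w)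
    (hi : Integrable (fun u : ℝ => u ^ (α.re - 1 - a) * (1 + u) ^ (-β.re)) pcM) :
    ‖pcP α β w‖ ≤ w ^ (-a) * ∫ u, u ^ (α.re - 1 - a) * (1 + u) ^ (-β.re) ∂pcM := by
  unfold pcP
  rw [← integral_const_mul]
  apply norm_integral_le_of_norm_le (hi.const_mul _)
  filter_upwards [pc_ae] with u hu
  exact pcP_integrand_le α β ha0 ha1 hw hu

noncomputable def pcG (α β z : ℂ) (ε x : ℝ) : ℂ :=
  cexp (-(1/2) * (x:ℂ) ^ 2 + (-I * z) * x) * ((ε - I * x) ^ (α - β) * pcP α β (ε ^ 2 + x ^ 2))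

lemma pcG_le {α β : ℂ} (z : ℂ) {a : ℝ} (ha0 : 0 ≤ a) (ha1 : a ≤ 1)
    (had : α.re - β.re ≤ 2 * a)
    (hi : Integrable (fun u : ℝ => u ^ (α.re - 1 - a) * (1 + u) ^ (-β.re)) pcM) :
    ∃ C : ℝ, ∀ ε x : ℝ, x ≠ 0 →
      ‖pcG α β z ε x‖ ≤ C * (|x| ^ (α.re - β.re - 2 * a) * Real.exp (-(1/4) * x ^ 2)) := by
  set J := ∫ u, u ^ (α.re - 1 - a) * (1 + u) ^ (-β.re) ∂pcM with hJ
  have hJ0 : 0 ≤ J := by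
    apply integral_nonneg_of_ae
    filter_upwards [pc_ae] with u hu
    simp only [Pi.zero_apply]
    positivity
  refine ⟨Real.exp (z.im ^ 2) * (Real.exp (Real.pi * |(α - β).im|) * J), fun ε x hx => ?_⟩
  have hx2 : 0 < x ^ 2 := by positivity
  have hw : 0 < ε ^ 2 + x ^ 2 := by positivity
  set w := ε ^ 2 + x ^ 2 with hwdef
  unfold pcG
  rw [norm_mul, norm_mul, ← hwdef]
  have h1 : ‖cexp (-(1/2) * (x:ℂ) ^ 2 + (-I * z) * x)‖ ≤
      Real.exp (z.im ^ 2) * Real.exp (-(1/4) * x ^ 2) := by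
    rw [Complex.norm_exp, ← Real.exp_add, Real.exp_le_exp]
    have : (-(1/2) * (x:ℂ) ^ 2 + (-I * z) * x).re = -(1/2) * x ^ 2 + z.im * x := by
      rw [← ofReal_pow]
      simp [-ofReal_pow]
    rw [this]
    nlinarith [sq_nonneg (z.im - x / 2)]
  have hq0 : (ε - I * x : ℂ) ≠ 0 := by
    intro h
    have := congrArg Complex.im h
    simp at this
    exact hx this
  have hqn : ‖(ε - I * x : ℂ)‖ = w ^ (1/2 : ℝ) := by
    rw [← Real.sqrt_eq_rpow, Complex.norm_def, normSq_apply]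
    congr 1
    simp [hwdef]; ring
  have h2 : ‖(ε - I * x : ℂ) ^ (α - β)‖ ≤
      w ^ ((α.re - β.re) / 2) * Real.exp (Real.pi * |(α - β).im|) := by
    rw [norm_cpow_of_ne_zero hq0, hqn, ← Real.rpow_mul hw.le, div_eq_mul_inv, ← Real.exp_neg]
    have e : (1/2 : ℝ) * (α - β).re = (α.re - β.re) / 2 := by simp; ring
    rw [e]
    gcongr
    refine (neg_le_abs _).trans ?_
    rw [abs_mul]
    gcongr
    exact abs_arg_le_pi _
  have h3 := pcP_le (α := α) (β := β) ha0 ha1 hw hi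
  rw [← hJ] at h3
  have h4 : w ^ ((α.re - β.re) / 2) * w ^ (-a) ≤ |x| ^ (α.re - β.re - 2 * a) := by
    rw [← Real.rpow_add hw]
    calc _ ≤ (x ^ 2) ^ ((α.re - β.re) / 2 + -a) :=
          Real.rpow_le_rpow_of_nonpos hx2 (by rw [hwdef]; nlinarith [sq_nonneg ε]) (by linarith)
      _ = _ := by
        rw [← sq_abs, ← Real.rpow_natCast, ← Real.rpow_mul (abs_nonneg x)]
        congr 1; push_cast; ring
  calc _ ≤ (Real.exp (z.im ^ 2) * Real.exp (-(1/4) * x ^ 2)) *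
        ((w ^ ((α.re - β.re) / 2) * Real.exp (Real.pi * |(α - β).im|)) * (w ^ (-a) * J)) := by
        gcongr
    _ = (Real.exp (z.im ^ 2) * (Real.exp (Real.pi * |(α - β).im|) * J)) *
        ((w ^ ((α.re - β.re) / 2) * w ^ (-a)) * Real.exp (-(1/4) * x ^ 2)) := by ring
    _ ≤ _ := by gcongr

lemma pcG_meas (α β z : ℂ) (ε : ℝ) : Measurable (pcG α β z ε) := by
  have := pcP_meas α β
  unfold pcG
  fun_prop

lemma pc_exists_a {α β : ℂ} (hα : 0 < α.re) (hd1 : -1 < α.re - β.re)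
    (hd2 : α.re - β.re < 1) (hβ : 0 < β.re) : ∃ a : ℝ, 0 ≤ a ∧ a ≤ 1 ∧ α.re - β.re ≤ 2 * a ∧
      -1 < α.re - β.re - 2 * a ∧
      Integrable (fun u : ℝ => u ^ (α.re - 1 - a) * (1 + u) ^ (-β.re)) pcM := by
  obtain ⟨a, h1, h2⟩ : ∃ a, max 0 (α.re - β.re) < a ∧ a < min α.re ((α.re - β.re + 1) / 2) := by
    apply exists_between
    simp only [max_lt_iff, lt_min_iff]
    refine ⟨⟨hα, by linarith⟩, by linarith, by linarith⟩
  simp only [max_lt_iff, lt_min_iff] at h1 h2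
  refine ⟨a, h1.1.le, by linarith, by linarith, by linarith, ?_⟩
  exact pc_beta_int (by linarith) hβ (by linarith)

lemma pcG_int {α β : ℂ} (z : ℂ) (hα : 0 < α.re) (hd1 : -1 < α.re - β.re)
    (hd2 : α.re - β.re < 1) (hβ : 0 < β.re) (ε : ℝ) : Integrable (pcG α β z ε) := by
  obtain ⟨a, ha0, ha1, had, hak, hi⟩ := pc_exists_a hα hd1 hd2 hβ
  obtain ⟨C, hC⟩ := pcG_le z ha0 ha1 had hi
  refine ((pc_abs_int hak).const_mul C).mono' (pcG_meas _ _ _ _).aestronglyMeasurable ?_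
  have h0 : ∀ᵐ x : ℝ, x ≠ 0 := by simp [ae_iff]
  filter_upwards [h0] with x hx using hC ε x hx

lemma pcG_lim {α β : ℂ} (z : ℂ) (hα : 0 < α.re) (hd1 : -1 < α.re - β.re)
    (hd2 : α.re - β.re < 1) (hβ : 0 < β.re) :
    Tendsto (fun ε : ℝ => ∫ x, pcG α β z ε x) (𝓝[>] 0) (𝓝 (∫ x, pcG α β z 0 x)) := by
  obtain ⟨a, ha0, ha1, had, hak, hi⟩ := pc_exists_a hα hd1 hd2 hβ
  obtain ⟨C, hC⟩ := pcG_le z ha0 ha1 had hi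
  have h0 : ∀ᵐ x : ℝ, x ≠ 0 := by simp [ae_iff]
  refine tendsto_integral_filter_of_dominated_convergence _
    (Eventually.of_forall fun ε => (pcG_meas _ _ _ _).aestronglyMeasurable)
    (Eventually.of_forall fun ε => ?_) ((pc_abs_int hak).const_mul C) ?_
  · filter_upwards [h0] with x hx using hC ε x hx
  · filter_upwards [h0] with x hx
    have hc : ContinuousAt (fun ε : ℝ => pcG α β z ε x) 0 := by
      unfold pcG
      have h1 : ContinuousAt (fun ε : ℝ => ((ε:ℂ) - I * x) ^ (α - β)) 0 := by
        apply ContinuousAt.cpow (by fun_prop) (by fun_prop)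
        right
        simpa using hx
      have h2 : ContinuousAt (fun ε : ℝ => pcP α β (ε ^ 2 + x ^ 2)) 0 := by
        have hw : 0 < (0:ℝ) ^ 2 + x ^ 2 := by positivity
        exact ContinuousAt.comp (g := pcP α β) (f := fun ε : ℝ => ε ^ 2 + x ^ 2)
          (pcP_cont ha0 ha1 hw hi) (by fun_prop)
      exact continuousAt_const.mul (h1.mul h2)
    exact hc.tendsto.mono_left nhdsWithin_le_nhds
lemma pc_gauss_int {α : ℂ} (hα : 0 < α.re) (z : ℂ) :
    Integrable (fun t : ℝ => cexp (z * t - (t:ℂ) ^ 2 / 2) * (t:ℂ) ^ (α - 1)) pcM := by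
  have h := (integrableOn_rpow_mul_exp_neg_mul_sq (b := 1/4) (by norm_num)
    (s := α.re - 1) (by linarith)).const_mul (Real.exp (z.re ^ 2))
  refine Integrable.mono' h (Measurable.aestronglyMeasurable (by fun_prop)) ?_
  filter_upwards [pc_ae] with t ht
  rw [norm_mul, norm_cpow_eq_rpow_re_of_pos ht, Complex.norm_exp]
  have e : (z * t - (t:ℂ) ^ 2 / 2).re = z.re * t - t ^ 2 / 2 := by
    rw [show (t:ℂ) ^ 2 / 2 = ((t ^ 2 / 2 : ℝ) : ℂ) by push_cast; rfl]
    simp [-ofReal_div, -ofReal_pow]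
  rw [e]
  have : Real.exp (z.re * t - t ^ 2 / 2) ≤ Real.exp (z.re ^ 2) * Real.exp (-(1/4) * t ^ 2) := by
    rw [← Real.exp_add, Real.exp_le_exp]
    nlinarith [sq_nonneg (z.re - t / 2)]
  have h3 : 0 ≤ t ^ (α.re - 1) := by positivity
  simp only [sub_re, one_re]
  nlinarith [mul_le_mul_of_nonneg_right this h3]

noncomputable def pcL (α β z : ℂ) (ε : ℝ) (v : ℝ × ℝ) : ℂ :=
  cexp (-z ^ 2 / 2) * ((cexp (-z * v.1 - (v.1:ℂ) ^ 2 / 2) * (v.1:ℂ) ^ (α - 1)) *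
    (cexp (z * v.2 - (v.2:ℂ) ^ 2 / 2) * (v.2:ℂ) ^ (β - 1))) *
    (Real.exp (-ε * (v.1 + v.2)) : ℝ)

lemma pcL_lim {α β : ℂ} (z : ℂ) (hα : 0 < α.re) (hβ : 0 < β.re) :
    Tendsto (fun ε : ℝ => ∫ v, pcL α β z ε v ∂(pcM.prod pcM)) (𝓝[>] 0)
      (𝓝 (∫ v, pcL α β z 0 v ∂(pcM.prod pcM))) := by
  have hint := (((pc_gauss_int hα (-z)).mul_prod (pc_gauss_int hβ z)).const_mul
    (cexp (-z ^ 2 / 2))).norm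
  refine tendsto_integral_filter_of_dominated_convergence _ ?_ ?_ hint ?_
  · refine Eventually.of_forall fun ε => Measurable.aestronglyMeasurable ?_
    unfold pcL
    fun_prop
  · filter_upwards [self_mem_nhdsWithin] with ε hε
    filter_upwards [pc_ae2] with v hv
    have hε : 0 < ε := hε
    unfold pcL
    rw [norm_mul]
    apply mul_le_of_le_one_right (norm_nonneg _)
    rw [norm_real, Real.norm_of_nonneg (Real.exp_pos _).le, Real.exp_le_one_iff]
    nlinarith [mul_pos hε hv.1, mul_pos hε hv.2]
  · refine Eventually.of_forall fun v => ?_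
    have : Continuous (fun ε : ℝ => pcL α β z ε v) := by
      unfold pcL
      fun_prop
    exact this.continuousAt.tendsto.mono_left nhdsWithin_le_nhds

lemma pcL_zero {α β : ℂ} (z : ℂ) :
    ∫ v, pcL α β z 0 v ∂(pcM.prod pcM) = cexp (-z ^ 2 / 2) *
      ((∫ t, cexp (-z * t - (t:ℂ) ^ 2 / 2) * (t:ℂ) ^ (α - 1) ∂pcM) *
      (∫ s, cexp (z * s - (s:ℂ) ^ 2 / 2) * (s:ℂ) ^ (β - 1) ∂pcM)) := by
  unfold pcL
  simp only [neg_zero, zero_mul, Real.exp_zero, ofReal_one, mul_one]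
  rw [integral_const_mul, ← integral_prod_mul]

lemma pc_triple {α β : ℂ} (z : ℂ) (hα : 0 < α.re) (hβ : 0 < β.re) {ε : ℝ} (hε : 0 < ε) :
    Integrable (fun y : ℝ × (ℝ × ℝ) => cexp (-(1/2) * (y.1:ℂ) ^ 2 + (-I * z) * y.1) *
      pcE α β (ε + I * y.1) (ε - I * y.1) y.2) (volume.prod (pcM.prod pcM)) := by
  have h1 : Integrable (fun x : ℝ => cexp (-(1/2) * (x:ℂ) ^ 2 + (-I * z) * x)) := by
    have := integrable_cexp_quadratic (b := 1/2) (by norm_num) (-I * z) 0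
    simpa using this
  have h2 := pcE_int (p := ε) (q := ε) hα hβ (by simpa using hε) (by simpa using hε)
  have h3 := (h1.mul_prod h2).norm
  refine h3.mono' ?_ ?_
  · apply Measurable.aestronglyMeasurable
    unfold pcE
    fun_prop
  · have h4 : ∀ᵐ y ∂((volume : Measure ℝ).prod (pcM.prod pcM)), 0 < y.2.1 ∧ 0 < y.2.2 :=
      Measure.quasiMeasurePreserving_snd.ae pc_ae2
    filter_upwards [h4] with y hy
    rw [norm_mul, norm_mul, pcE_norm _ _ _ _ _ hy, pcE_norm _ _ _ _ _ hy]
    simp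

lemma pcL_eq {α β : ℂ} (z : ℂ) (hα : 0 < α.re) (hβ : 0 < β.re) {ε : ℝ} (hε : 0 < ε) :
    (Real.sqrt (2 * Real.pi) : ℂ) * ∫ v, pcL α β z ε v ∂(pcM.prod pcM) =
      Complex.Gamma β * ∫ x, pcG α β z ε x := by
  have ht := pc_triple z hα hβ hε
  have e1 := integral_prod _ ht
  have e2 := integral_prod_symm _ ht
  rw [e1] at e2
  have e3 : ∀ x : ℝ, ∫ v, cexp (-(1/2) * (x:ℂ) ^ 2 + (-I * z) * x) *
      pcE α β (ε + I * x) (ε - I * x) v ∂(pcM.prod pcM) = Complex.Gamma β * pcG α β z ε x := by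
    intro x
    rw [integral_const_mul]
    have hN : 0 < ε ^ 2 + x ^ 2 := by positivity
    have hq : 0 < (ε - I * x : ℂ).re := by simpa using hε
    have hq0 : (ε - I * x : ℂ) ≠ 0 := by
      intro h; rw [h] at hq; simp at hq
    have hp : (ε + I * x : ℂ) = ((ε ^ 2 + x ^ 2 : ℝ) : ℂ) / (ε - I * x) := by
      rw [eq_div_iff hq0]
      push_cast
      ring_nf
      rw [I_sq]; ring
    rw [hp, pc_key hα hβ hN hq, pcG]
    ring
  have e4 : ∀ v : ℝ × ℝ, ∫ x : ℝ, cexp (-(1/2) * (x:ℂ) ^ 2 + (-I * z) * x) *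
      pcE α β (ε + I * x) (ε - I * x) v = (Real.sqrt (2 * Real.pi) : ℂ) * pcL α β z ε v := by
    intro v
    have h := integral_cexp_quadratic (b := -(1/2)) (by norm_num)
      (-I * (z + v.1 - v.2)) (-ε * (v.1 + v.2) - v.1 * v.2)
    have e : ∀ x : ℝ, cexp (-(1/2) * (x:ℂ) ^ 2 + (-I * z) * x) *
      pcE α β (ε + I * x) (ε - I * x) v =
      cexp (-(1/2) * (x:ℂ) ^ 2 + (-I * (z + v.1 - v.2)) * x + (-ε * (v.1 + v.2) - v.1 * v.2)) *
        ((v.1:ℂ) ^ (α - 1) * (v.2:ℂ) ^ (β - 1)) := by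
      intro x
      rw [pcE, ← mul_assoc, ← Complex.exp_add]
      congr 2
      ring
    simp_rw [e]
    rw [integral_mul_const, h, pcL]
    have hs : ((Real.pi : ℂ) / -(-(1/2))) ^ (1/2 : ℂ) = (Real.sqrt (2 * Real.pi) : ℂ) := by
      rw [Real.sqrt_eq_rpow, ofReal_cpow (by positivity)]
      push_cast
      congr 1
      ring
    rw [hs]
    have hx : cexp (-ε * (v.1 + v.2) - v.1 * v.2 -
        (-I * (z + v.1 - v.2)) ^ 2 / (4 * -(1/2))) =
        cexp (-z ^ 2 / 2) * cexp (-z * v.1 - (v.1:ℂ) ^ 2 / 2) *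
        cexp (z * v.2 - (v.2:ℂ) ^ 2 / 2) * (Real.exp (-ε * (v.1 + v.2)) : ℝ) := by
      rw [ofReal_exp, ← Complex.exp_add, ← Complex.exp_add, ← Complex.exp_add]
      congr 1
      rw [mul_pow, neg_sq, I_sq]
      push_cast
      ring
    rw [hx]
    ring
  simp only [e3, e4] at e2
  rw [integral_const_mul, integral_const_mul] at e2
  exact e2.symm

lemma pc_main {α β : ℂ} (z : ℂ) (hα : 0 < α.re) (hβ : 0 < β.re) (hd1 : -1 < α.re - β.re)
    (hd2 : α.re - β.re < 1) :
    (Real.sqrt (2 * Real.pi) : ℂ) * ∫ v, pcL α β z 0 v ∂(pcM.prod pcM) =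
      Complex.Gamma β * ∫ x, pcG α β z 0 x := by
  have h1 := (pcL_lim z hα hβ).const_mul (Real.sqrt (2 * Real.pi) : ℂ)
  have h2 := (pcG_lim z hα hd1 hd2 hβ).const_mul (Complex.Gamma β)
  refine tendsto_nhds_unique (h1.congr' ?_) h2
  filter_upwards [self_mem_nhdsWithin] with ε hε using pcL_eq z hα hβ hε

lemma pcG_fold {α β : ℂ} (z μ : ℂ) (hμ : α - β = μ - 1)
    (hα : 0 < α.re) (hβ : 0 < β.re) (hd1 : -1 < α.re - β.re)
    (hd2 : α.re - β.re < 1) :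
    ∫ x, pcG α β z 0 x = 2 * ∫ x, Complex.sin (z * x + (Real.pi : ℂ) * μ / 2) *
        (x:ℂ) ^ (μ - 1) * cexp (-(x:ℂ) ^ 2 / 2) * pcP α β (x ^ 2) ∂pcM := by
  have hi := pcG_int z hα hd1 hd2 hβ 0
  rw [← intervalIntegral.integral_Iic_add_Ioi (b := 0) hi.integrableOn hi.integrableOn]
  have hneg := integral_comp_neg_Ioi 0 (pcG α β z 0)
  rw [neg_zero] at hneg
  rw [← hneg, ← integral_add hi.comp_neg.integrableOn hi.integrableOn, ← integral_const_mul, pcM]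
  apply setIntegral_congr_fun measurableSet_Ioi
  intro x hx
  have hx : 0 < x := hx
  have hxc : (x:ℂ) ≠ 0 := by exact_mod_cast hx.ne'
  have p1 : ((0:ℝ) - I * x : ℂ) ^ (μ - 1) =
      (x:ℂ) ^ (μ - 1) * cexp (-(Real.pi / 2) * I * (μ - 1)) := by
    have : ((0:ℝ) - I * x : ℂ) = x * (-I) := by push_cast; ring
    rw [this, cpow_def_of_ne_zero (by simp [hxc]), cpow_def_of_ne_zero hxc,
      log_ofReal_mul hx (by simp), log_neg_I, ofReal_log hx.le, add_mul, Complex.exp_add]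
  have p2 : ((0:ℝ) - I * (-x : ℝ) : ℂ) ^ (μ - 1) =
      (x:ℂ) ^ (μ - 1) * cexp ((Real.pi / 2) * I * (μ - 1)) := by
    have : ((0:ℝ) - I * (-x : ℝ) : ℂ) = x * I := by push_cast; ring
    rw [this, cpow_def_of_ne_zero (by simp [hxc]), cpow_def_of_ne_zero hxc,
      log_ofReal_mul hx (by simp), log_I, ofReal_log hx.le, add_mul, Complex.exp_add]
  have hsin : Complex.sin (z * x + (Real.pi : ℂ) * μ / 2) =
      Complex.cos (z * x + (Real.pi : ℂ) * (μ - 1) / 2) := by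
    rw [← Complex.cos_sub_pi_div_two]
    congr 1; ring
  simp only [pcG]
  rw [hμ, p1, p2, hsin, Complex.cos]
  have q1 : cexp (-(1/2) * (x:ℂ) ^ 2 + (-I * z) * x) =
      cexp (-(x:ℂ) ^ 2 / 2) * cexp (-I * z * x) := by
    rw [← Complex.exp_add]; congr 1; ring
  have q2 : cexp (-(1/2) * ((-x : ℝ):ℂ) ^ 2 + (-I * z) * (-x : ℝ)) =
      cexp (-(x:ℂ) ^ 2 / 2) * cexp (I * z * x) := by
    rw [← Complex.exp_add]; congr 1; push_cast; ring
  have q3 : cexp ((z * x + (Real.pi : ℂ) * (μ - 1) / 2) * I) =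
      cexp (I * z * x) * cexp ((Real.pi / 2) * I * (μ - 1)) := by
    rw [← Complex.exp_add]; congr 1; ring
  have q4 : cexp (-(z * x + (Real.pi : ℂ) * (μ - 1) / 2) * I) =
      cexp (-I * z * x) * cexp (-(Real.pi / 2) * I * (μ - 1)) := by
    rw [← Complex.exp_add]; congr 1; ring
  have q5 : (0:ℝ) ^ 2 + (-x) ^ 2 = x ^ 2 := by ring
  have q6 : (0:ℝ) ^ 2 + x ^ 2 = x ^ 2 := by ring
  rw [q1, q2, q3, q4, q5, q6]
  ring


/-- Theorem 2, eq. (20) with `a = 1`: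
`D₋ν(z) D_(μ-ν-1)(-z) = (2/√(2π)) ∫₀^∞ sin(zx + πμ/2) x^(μ-1) e^(-x²/2) Ψ(ν,μ;x²) dx`,
with Ψ and each D written via their integral representations. -/
theorem product_parabolic_cylinder_fourier_sine_shift
    (ν μ z : ℂ) (hν : 0 < ν.re) (hμ0 : 0 < μ.re) (hμ2 : μ.re < 2)
    (hμν : μ.re < ν.re + 1) :
    (Complex.exp (-z^2 / 2) / (Complex.Gamma ν * Complex.Gamma (ν + 1 - μ))) *
      (∫ t in Ioi (0:ℝ), Complex.exp (-z * t - (t:ℂ)^2 / 2) * (t:ℂ) ^ (ν - 1)) *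
      (∫ s in Ioi (0:ℝ), Complex.exp (z * s - (s:ℂ)^2 / 2) * (s:ℂ) ^ (ν - μ)) =
    ((Real.sqrt (2 / Real.pi) : ℝ) : ℂ) *
      ∫ x in Ioi (0:ℝ), Complex.sin (z * x + (Real.pi : ℂ) * μ / 2) *
        (x:ℂ) ^ (μ - 1) * Complex.exp (-(x:ℂ)^2 / 2) *
        ((1 / Complex.Gamma ν) *
          ∫ u in Ioi (0:ℝ), Complex.exp (-(x:ℂ)^2 * u) * (u:ℂ) ^ (ν - 1) *
            ((1:ℂ) + (u:ℂ)) ^ (μ - ν - 1)) := by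
  have hβ : 0 < (ν + 1 - μ).re := by simp; linarith
  have hd1 : -1 < ν.re - (ν + 1 - μ).re := by simp; linarith
  have hd2 : ν.re - (ν + 1 - μ).re < 1 := by simp; linarith
  have h := pc_main z hν hβ hd1 hd2
  rw [pcL_zero, pcG_fold z μ (by ring) hν hβ hd1 hd2] at h
  have eP : ∀ x : ℝ, (∫ u in Ioi (0:ℝ), Complex.exp (-(x:ℂ)^2 * u) * (u:ℂ) ^ (ν - 1) *
            ((1:ℂ) + (u:ℂ)) ^ (μ - ν - 1)) = pcP ν (ν + 1 - μ) (x ^ 2) := by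
    intro x
    rw [pcP, pcM]
    push_cast
    rw [show -(ν + 1 - μ) = μ - ν - 1 by ring]
  simp only [eP]
  rw [show ν + 1 - μ - 1 = ν - μ by ring] at h
  simp only [pcM] at h
  set A := ∫ t in Ioi (0:ℝ), Complex.exp (-z * t - (t:ℂ)^2 / 2) * (t:ℂ) ^ (ν - 1)
  set B := ∫ s in Ioi (0:ℝ), Complex.exp (z * s - (s:ℂ)^2 / 2) * (s:ℂ) ^ (ν - μ)
  have hR : ∀ x : ℝ, Complex.sin (z * x + (Real.pi : ℂ) * μ / 2) *
        (x:ℂ) ^ (μ - 1) * Complex.exp (-(x:ℂ)^2 / 2) *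
        ((1 / Complex.Gamma ν) * pcP ν (ν + 1 - μ) (x ^ 2)) = (1 / Complex.Gamma ν) *
        (Complex.sin (z * x + (Real.pi : ℂ) * μ / 2) *
        (x:ℂ) ^ (μ - 1) * Complex.exp (-(x:ℂ)^2 / 2) * pcP ν (ν + 1 - μ) (x ^ 2)) := by
    intro x; ring
  simp_rw [hR]
  rw [integral_const_mul]
  set T := ∫ x in Ioi (0:ℝ), Complex.sin (z * x + (Real.pi : ℂ) * μ / 2) *
        (x:ℂ) ^ (μ - 1) * Complex.exp (-(x:ℂ)^2 / 2) * pcP ν (ν + 1 - μ) (x ^ 2)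
  have g1 : Complex.Gamma ν ≠ 0 := Complex.Gamma_ne_zero_of_re_pos hν
  have g2 : Complex.Gamma (ν + 1 - μ) ≠ 0 := Complex.Gamma_ne_zero_of_re_pos hβ
  have hs0 : (Real.sqrt (2 * Real.pi) : ℂ) ≠ 0 := by
    have : 0 < Real.sqrt (2 * Real.pi) := by positivity
    exact_mod_cast this.ne'
  have hs : (Real.sqrt (2 * Real.pi) : ℂ) * (Real.sqrt (2 / Real.pi) : ℂ) = 2 := by
    rw [← ofReal_mul, ← Real.sqrt_mul (by positivity),
      show 2 * Real.pi * (2 / Real.pi) = 2 ^ 2 by field_simp,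
      Real.sqrt_sq (by norm_num)]
    norm_num
  apply mul_left_cancel₀ hs0
  rw [← mul_assoc _ (Real.sqrt (2 / Real.pi) : ℂ), hs]
  rw [show -z ^ 2 / 2 = -(z ^ 2 / 2) by ring] at h ⊢
  field_simp
  linear_combination h
end
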